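/- For every η₁ > 0 there exist an integer n₀ and a real η₂ > 0 such that the following holds: if G is an oriented graph on n ≥ n₀ vertices in which every vertex has both indegree and outdegree at least (1/2 − η₂)n, then G contains at least (1/2 − η₁)n pairwise edge-disjoint Hamilton cycles. -/

import Mathlib

open scoped Classical

/-- Outdegree of a vertex in a digraph given as a relation. -/
noncomputable def outDeg {V : Type*} [Fintype V] (G : V → V → Prop) (v : V) : ℕ :=
  (Finset.univ.filter fun u => G v u).card

/-- Indegree of a vertex in a digraph given as a relation. -/
noncomputable def inDeg {V : Type*} [Fintype V] (G : V → V → Prop) (v : V) : ℕ :=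
  (Finset.univ.filter fun u => G u v).card

/-- A Hamilton cycle of a digraph `G`, encoded as a permutation which is a single cycle
moving every vertex, all of whose transition edges lie in `G`. -/
def IsHamCycle {V : Type*} [Fintype V] [DecidableEq V] (G : V → V → Prop)
    (σ : Equiv.Perm V) : Prop :=
  σ.IsCycle ∧ (∀ v, σ v ≠ v) ∧ (∀ v, G v (σ v))

/-- A permutation all of whose points lie on one cycle. -/
def IsFullCycle {V : Type*} (σ : Equiv.Perm V) : Prop := ∀ x y, σ.SameCycle x y

section Cycles

variable {V : Type*}

/-- Two permutations agreeing along a `σ`-trajectory have the same trajectory. -/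
lemma pow_eq_of_agree (σ τ : Equiv.Perm V) (y : V) (d : ℕ)
    (h : ∀ m, m < d → τ ((σ ^ m) y) = σ ((σ ^ m) y)) : (τ ^ d) y = (σ ^ d) y := by
  induction d with
  | zero => simp
  | succ d ih =>
    rw [pow_succ', Equiv.Perm.mul_apply, ih (fun m hm => h m (by omega)), h d (by omega),
      pow_succ', Equiv.Perm.mul_apply]

lemma sameCycle_of_agree (σ τ : Equiv.Perm V) (y : V) (d : ℕ)
    (h : ∀ m, m < d → τ ((σ ^ m) y) = σ ((σ ^ m) y)) : τ.SameCycle y ((σ ^ d) y) :=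
  ⟨d, by rw [zpow_natCast]; exact pow_eq_of_agree σ τ y d h⟩

lemma sameCycle_apply_of_agree (σ τ : Equiv.Perm V) (y : V) (d : ℕ) (hd : 1 ≤ d)
    (h : ∀ m, 0 < m → m < d → τ ((σ ^ m) y) = σ ((σ ^ m) y)) :
    τ.SameCycle (σ y) ((σ ^ d) y) := by
  obtain ⟨e, rfl⟩ : ∃ e, d = e + 1 := ⟨d - 1, by omega⟩
  have := sameCycle_of_agree σ τ (σ y) e (fun m hm => by
    have := h (m + 1) (by omega) (by omega)
    rwa [pow_succ, Equiv.Perm.mul_apply] at this)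
  rwa [pow_succ, Equiv.Perm.mul_apply]

variable [Fintype V] [DecidableEq V]

lemma sameCycle_mul_swap_self (σ : Equiv.Perm V) {p q : V} (hpq : ¬ σ.SameCycle p q) :
    (σ * Equiv.swap p q).SameCycle p (σ p) := by
  have hex : ∃ d, 0 < d ∧ (σ ^ d) p = p :=
    ⟨orderOf σ, orderOf_pos σ, by rw [pow_orderOf_eq_one]; rfl⟩
  obtain ⟨hd0, hd⟩ := Nat.find_spec hex
  have := sameCycle_apply_of_agree σ (σ * Equiv.swap p q) p (Nat.find hex) hd0 (fun m h0 hm => by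
    have h1 : (σ ^ m) p ≠ p := fun h => Nat.find_min hex hm ⟨h0, h⟩
    have h2 : (σ ^ m) p ≠ q := fun h => hpq ⟨m, by rw [zpow_natCast]; exact h⟩
    rw [Equiv.Perm.mul_apply, Equiv.swap_apply_of_ne_of_ne h1 h2])
  rw [hd] at this
  exact this.symm

lemma sameCycle_mul_swap (σ : Equiv.Perm V) {p q : V} (hpq : ¬ σ.SameCycle p q) :
    (σ * Equiv.swap p q).SameCycle p q ∧
      ∀ a b, σ.SameCycle a b → (σ * Equiv.swap p q).SameCycle a b := by
  have hp := sameCycle_mul_swap_self σ hpq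
  have hq := sameCycle_mul_swap_self σ (fun h => hpq h.symm)
  rw [Equiv.swap_comm] at hq
  have step : ∀ a, (σ * Equiv.swap p q).SameCycle a (σ a) := by
    intro a
    by_cases h1 : a = p
    · subst h1; exact hp
    by_cases h2 : a = q
    · subst h2; exact hq
    refine ⟨1, ?_⟩
    rw [zpow_one, Equiv.Perm.mul_apply, Equiv.swap_apply_of_ne_of_ne h1 h2]
  refine ⟨?_, ?_⟩
  · have : (σ * Equiv.swap p q).SameCycle q (σ p) := by
      refine ⟨1, ?_⟩
      rw [zpow_one, Equiv.Perm.mul_apply, Equiv.swap_apply_right]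
    exact hp.trans this.symm
  · intro a b hab
    obtain ⟨i, -, rfl⟩ := hab.exists_pow_eq'
    clear hab
    induction i with
    | zero => exact Equiv.Perm.SameCycle.refl _ _
    | succ i ih =>
      rw [pow_succ', Equiv.Perm.mul_apply]
      exact ih.trans (step _)

/-- A nonempty family of permutations closed under the swaps in `R` has a member whose cycles
contain all pairs related by `R`. -/
lemma exists_sameCycle_of_closed_swap (F : Set (Equiv.Perm V)) (hF : F.Nonempty)
    (R : V → V → Prop) (hR : ∀ σ ∈ F, ∀ p q, R p q → σ * Equiv.swap p q ∈ F) :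
    ∃ σ ∈ F, ∀ p q, R p q → σ.SameCycle p q := by
  obtain ⟨σ, hσ, hmax⟩ := Set.exists_max_image F
    (fun σ => (Finset.univ.filter fun x : V × V => σ.SameCycle x.1 x.2).card)
    (Set.toFinite F) hF
  refine ⟨σ, hσ, fun p q hpq => ?_⟩
  by_contra hn
  obtain ⟨h1, h2⟩ := sameCycle_mul_swap σ hn
  have := hmax _ (hR σ hσ p q hpq)
  refine absurd this (not_le.mpr (Finset.card_lt_card ?_))
  rw [Finset.ssubset_iff_of_subset]
  · exact ⟨(p, q), by simpa using h1, by simpa using hn⟩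
  · intro x hx
    simp only [Finset.mem_filter, Finset.mem_univ, true_and] at hx ⊢
    exact h2 _ _ hx

/-- A permutation all of whose cycles meet `B` can be modified on `B` to a full cycle. -/
lemma exists_isFullCycle_agree (σ : Equiv.Perm V) (B : Finset V)
    (hB : ∀ v, ∃ i : ℕ, (σ ^ i) v ∈ B) :
    ∃ τ : Equiv.Perm V, IsFullCycle τ ∧ ∀ v, v ∉ B → τ v = σ v := by
  obtain ⟨τ, hτ, h⟩ := exists_sameCycle_of_closed_swap
    {τ : Equiv.Perm V | ∀ v, v ∉ B → τ v = σ v} ⟨σ, fun _ _ => rfl⟩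
    (fun p q => p ∈ B ∧ q ∈ B) (by
      rintro τ hτ p q ⟨hp, hq⟩ v hv
      have h1 : v ≠ p := by rintro rfl; exact hv hp
      have h2 : v ≠ q := by rintro rfl; exact hv hq
      rw [Equiv.Perm.mul_apply, Equiv.swap_apply_of_ne_of_ne h1 h2, hτ v hv])
  refine ⟨τ, ?_, hτ⟩
  have key : ∀ v, ∃ b ∈ B, τ.SameCycle v b := by
    intro v
    refine ⟨_, Nat.find_spec (hB v), sameCycle_of_agree σ τ v _ fun m hm => ?_⟩
    exact hτ _ (Nat.find_min (hB v) hm)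
  intro x y
  obtain ⟨b, hb, hxb⟩ := key x
  obtain ⟨c, hc, hyc⟩ := key y
  exact hxb.trans ((h b c ⟨hb, hc⟩).trans hyc.symm)

end Cycles

section Gadget

variable {V ι κ : Type*} [Fintype V] [DecidableEq V] [Nonempty ι]

/-- Rewiring a full cycle `σ` along a chain of single vertices and a doubled closed walk: if every
doubled pair is consecutive among the chosen vertices and every chain vertex is followed by a
doubled vertex, the rewiring can be chosen to be a full cycle again. -/
lemma exists_isFullCycle_rewire (σ : Equiv.Perm V) (hσ : IsFullCycle σ)
    (s : Equiv.Perm ι) (t : Equiv.Perm κ)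
    (hs : ∀ P : ι → Prop, (∀ i, P i → P (s i)) → ∀ i j, P i → P j)
    (e : (ι × Bool) ⊕ κ → V) (he : Function.Injective e)
    (hpair : ∀ i, ∃ d, 1 ≤ d ∧ (σ ^ d) (e (.inl (i, false))) = e (.inl (i, true)) ∧
      ∀ m, 0 < m → m < d → (σ ^ m) (e (.inl (i, false))) ∉ Set.range e)
    (hchain : ∀ j, ∃ d, 1 ≤ d ∧ (∃ x, (σ ^ d) (e (.inr j)) = e (.inl x)) ∧
      ∀ m, 0 < m → m < d → (σ ^ m) (e (.inr j)) ∉ Set.range e) :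
    ∃ τ : Equiv.Perm V, IsFullCycle τ ∧ (∀ v, v ∉ Set.range e → τ v = σ v) ∧
      (∀ i b, ∃ b', τ (e (.inl (i, b))) = σ (e (.inl (s i, b')))) ∧
      (∀ j, τ (e (.inr j)) = σ (e (.inr (t j)))) := by
  obtain ⟨τ, ⟨h1, h2, h3⟩, hτ⟩ := exists_sameCycle_of_closed_swap
    {τ : Equiv.Perm V | (∀ v, v ∉ Set.range e → τ v = σ v) ∧
      (∀ i b, ∃ b', τ (e (.inl (i, b))) = σ (e (.inl (s i, b')))) ∧
      (∀ j, τ (e (.inr j)) = σ (e (.inr (t j))))}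
    (by
      let π : Equiv.Perm ((ι × Bool) ⊕ κ) := Equiv.sumCongr (s.prodCongr (Equiv.refl Bool)) t
      refine ⟨σ * Equiv.Perm.viaEmbedding π ⟨e, he⟩, ?_, ?_, ?_⟩
      · intro v hv
        rw [Equiv.Perm.mul_apply, Equiv.Perm.viaEmbedding_apply_of_notMem]
        exact hv
      · intro i b
        refine ⟨b, ?_⟩
        have := Equiv.Perm.viaEmbedding_apply π ⟨e, he⟩ (.inl (i, b))
        rw [Equiv.Perm.mul_apply]
        exact congrArg σ this
      · intro j
        have := Equiv.Perm.viaEmbedding_apply π ⟨e, he⟩ (.inr j)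
        rw [Equiv.Perm.mul_apply]
        exact congrArg σ this)
    (fun p q => ∃ i, p = e (.inl (i, false)) ∧ q = e (.inl (i, true))) (by
      rintro τ ⟨h1, h2, h3⟩ p q ⟨i, rfl, rfl⟩
      refine ⟨?_, ?_, ?_⟩
      · intro v hv
        have n1 : v ≠ e (.inl (i, false)) := by rintro rfl; exact hv ⟨_, rfl⟩
        have n2 : v ≠ e (.inl (i, true)) := by rintro rfl; exact hv ⟨_, rfl⟩
        rw [Equiv.Perm.mul_apply, Equiv.swap_apply_of_ne_of_ne n1 n2, h1 v hv]
      · intro k b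
        rw [Equiv.Perm.mul_apply]
        by_cases hk : k = i
        · subst hk
          cases b
          · rw [Equiv.swap_apply_left]; exact h2 _ _
          · rw [Equiv.swap_apply_right]; exact h2 _ _
        · rw [Equiv.swap_apply_of_ne_of_ne]
          · exact h2 _ _
          · intro h; have := he h; simp at this; exact hk this.1
          · intro h; have := he h; simp at this; exact hk this.1
      · intro j
        rw [Equiv.Perm.mul_apply, Equiv.swap_apply_of_ne_of_ne]
        · exact h3 j
        · intro h; have := he h; simp at this
        · intro h; have := he h; simp at this)
  refine ⟨τ, ?_, h1, h2, h3⟩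
  have hpq : ∀ i b b', τ.SameCycle (e (.inl (i, b))) (e (.inl (i, b'))) := by
    intro i b b'
    have := hτ _ _ ⟨i, rfl, rfl⟩
    cases b <;> cases b'
    · exact Equiv.Perm.SameCycle.refl _ _
    · exact this
    · exact this.symm
    · exact Equiv.Perm.SameCycle.refl _ _
  have one : ∀ v, τ.SameCycle v (τ v) := fun v => ⟨1, by simp⟩
  have hnext : ∀ i, ∃ b, τ (e (.inl (i, b))) = σ (e (.inl (s i, false))) := by
    intro i
    obtain ⟨b0, hb0⟩ := h2 i false
    obtain ⟨b1, hb1⟩ := h2 i true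
    cases b0
    · exact ⟨_, hb0⟩
    cases b1
    · exact ⟨_, hb1⟩
    rw [← hb1] at hb0
    have := he (τ.injective hb0)
    simp at this
  have hstep : ∀ i b b', τ.SameCycle (e (.inl (i, b))) (e (.inl (s i, b'))) := by
    intro i b b'
    obtain ⟨c, hc⟩ := hnext i
    obtain ⟨d, hd, hd1, hd2⟩ := hpair (s i)
    have := sameCycle_apply_of_agree σ τ _ d hd (fun m m0 m1 => h1 _ (hd2 m m0 m1))
    rw [hd1, ← hc] at this
    exact (hpq i b c).trans ((one _).trans (this.trans (hpq _ _ _)))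
  obtain ⟨i0⟩ := ‹Nonempty ι›
  have hall : ∀ i b, τ.SameCycle (e (.inl (i0, false))) (e (.inl (i, b))) := by
    intro i
    refine hs (fun i => ∀ b, τ.SameCycle (e (.inl (i0, false))) (e (.inl (i, b)))) ?_ i0 i ?_
    · intro i hi b
      exact (hi false).trans (hstep _ _ _)
    · exact fun b => hpq _ _ _
  have hallc : ∀ j, τ.SameCycle (e (.inl (i0, false))) (e (.inr j)) := by
    intro j
    have h := h3 (t.symm (t j))
    obtain ⟨d, hd, ⟨⟨i, b⟩, hd1⟩, hd2⟩ := hchain (t j)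
    have := sameCycle_apply_of_agree σ τ _ d hd (fun m m0 m1 => h1 _ (hd2 m m0 m1))
    rw [hd1, ← h3 j] at this
    exact (hall i b).trans (this.symm.trans (one _).symm)
  have hrange : ∀ v, τ.SameCycle (e (.inl (i0, false))) v := by
    intro v
    have hex : ∃ d : ℕ, (σ ^ d) v ∈ Set.range e := by
      obtain ⟨d, -, hd⟩ := (hσ v (e (.inl (i0, false)))).exists_pow_eq'
      exact ⟨d, _, hd.symm⟩
    have := sameCycle_of_agree σ τ v _ (fun m hm => h1 _ (Nat.find_min hex hm))
    obtain ⟨x, hx⟩ := Nat.find_spec hex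
    rw [← hx] at this
    refine Equiv.Perm.SameCycle.trans ?_ this.symm
    rcases x with ⟨i, b⟩ | j
    · exact hall i b
    · exact hallc j
  exact fun x y => (hrange x).symm.trans (hrange y)

end Gadget

section Doubling

lemma sq_card_le_card_same {V : Type*} [Fintype V] (c : V → ℕ) (G : Finset V) :
    (G.card : ℝ) ^ 2 ≤ ((Finset.univ.image c).card : ℝ) *
      ((Finset.univ.filter fun p : V × V => c p.1 = c p.2 ∧ p.1 ∈ G ∧ p.2 ∈ G).card : ℝ) := by
  set I := Finset.univ.image c
  have h1 : G.card = ∑ a ∈ I, (G.filter fun x => c x = a).card :=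
    Finset.card_eq_sum_card_fiberwise (fun x _ => by simp [I])
  have h2 : (Finset.univ.filter fun p : V × V => c p.1 = c p.2 ∧ p.1 ∈ G ∧ p.2 ∈ G).card
      = ∑ a ∈ I, ((G.filter fun x => c x = a).card) ^ 2 := by
    rw [Finset.card_eq_sum_card_fiberwise (f := fun p : V × V => c p.1) (t := I)
      (fun x _ => by simp [I])]
    refine Finset.sum_congr rfl fun a _ => ?_
    rw [sq, ← Finset.card_product]
    congr 1
    ext ⟨x, y⟩
    simp only [Finset.mem_filter, Finset.mem_univ, true_and, Finset.mem_product]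
    constructor
    · rintro ⟨⟨h, hx, hy⟩, ha⟩
      exact ⟨⟨hx, ha⟩, hy, h ▸ ha⟩
    · rintro ⟨⟨hx, ha⟩, hy, hb⟩
      exact ⟨⟨ha.trans hb.symm, hx, hy⟩, ha⟩
  rw [h1, h2]
  push_cast
  exact sq_sum_le_card_mul_sum_sq

lemma exists_pair_large_common {V Y : Type*} [Fintype V] [Fintype Y] (c pos : V → ℕ)
    (hpos : Function.Injective pos) (M : ℕ) (δ : ℝ) (hδ : 0 < δ) (hM : 4 ≤ δ ^ 2 * M)
    (hfib : ∀ a, (Finset.univ.filter fun v => c v = a).card ≤ M)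
    (hK : (Finset.univ.image c).card * M ≤ 2 * Fintype.card V)
    (R : V → Y → Prop) (hV : 0 < Fintype.card V) (hY : 0 < Fintype.card Y)
    (hR : δ * (Fintype.card V * Fintype.card Y) ≤
      ∑ y, ((Finset.univ.filter fun x => R x y).card : ℝ)) :
    ∃ x x', c x = c x' ∧ pos x < pos x' ∧
      δ ^ 2 / 8 * Fintype.card Y ≤ ((Finset.univ.filter fun y => R x y ∧ R x' y).card : ℝ) := by
  by_contra! hcon
  set n : ℝ := ((Fintype.card V : ℕ) : ℝ)
  set N : ℝ := ((Fintype.card Y : ℕ) : ℝ)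
  set K : ℝ := ((Finset.univ.image c).card : ℝ)
  have hn : 0 < n := by simp only [n]; exact_mod_cast hV
  have hN : 0 < N := by simp only [N]; exact_mod_cast hY
  have hcon' : ∀ x x', c x = c x' → x ≠ x' →
      ((Finset.univ.filter fun y => R x y ∧ R x' y).card : ℝ) ≤ δ ^ 2 / 8 * N := by
    intro x x' h1 h2
    rcases lt_or_gt_of_ne (fun h => h2 (hpos h)) with h | h
    · exact (hcon x x' h1 h).le
    · have := (hcon x' x h1.symm h).le
      simpa only [and_comm] using this
  let T : Y → ℝ := fun y =>
    ((Finset.univ.filter fun p : V × V => c p.1 = c p.2 ∧ R p.1 y ∧ R p.2 y).card : ℝ)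
  have hcs : (∑ y, ((Finset.univ.filter fun x => R x y).card : ℝ)) ^ 2 ≤ N * (K * ∑ y, T y) := by
    refine (sq_sum_le_card_mul_sum_sq).trans ?_
    rw [Finset.card_univ]
    refine mul_le_mul_of_nonneg_left ?_ hN.le
    rw [Finset.mul_sum]
    refine Finset.sum_le_sum fun y _ => ?_
    have := sq_card_le_card_same c (Finset.univ.filter fun x => R x y)
    simpa only [Finset.mem_filter, Finset.mem_univ, true_and] using this
  have hT : ∑ y, T y ≤ n * N + n * M * (δ ^ 2 / 8 * N) := by
    have e1 : ∑ y, T y = ∑ p : V × V, if c p.1 = c p.2 then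
        ((Finset.univ.filter fun y => R p.1 y ∧ R p.2 y).card : ℝ) else 0 := by
      simp only [T, Finset.card_filter, Nat.cast_sum]
      rw [Finset.sum_comm]
      refine Finset.sum_congr rfl fun p _ => ?_
      split_ifs with h
      · simp [h]
      · simp [h]
    rw [e1, Fintype.sum_prod_type]
    have e2 : ∀ x, (∑ x', if c x = c x' then
        ((Finset.univ.filter fun y => R x y ∧ R x' y).card : ℝ) else 0) ≤
        N + M * (δ ^ 2 / 8 * N) := by
      intro x
      have e3 : (∑ x', if c x = c x' then
        ((Finset.univ.filter fun y => R x y ∧ R x' y).card : ℝ) else 0) ≤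
        ∑ x', ((if x' = x then N else 0) + if c x' = c x then δ ^ 2 / 8 * N else 0) := by
        refine Finset.sum_le_sum fun x' _ => ?_
        by_cases h : x' = x
        · subst h
          simp only [if_true, and_self]
          have : ((Finset.univ.filter fun y => R x' y).card : ℝ) ≤ N := by
            simp only [N]; exact_mod_cast Finset.card_le_univ _
          have : 0 ≤ δ ^ 2 / 8 * N := by positivity
          linarith
        · by_cases h' : c x = c x'
          · simp only [h', h, if_true, if_false, zero_add]
            exact hcon' x x' h' (fun h2 => h h2.symm)
          · have h'' : ¬ c x' = c x := fun h2 => h' h2.symm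
            simp [h', h, h'']
      refine e3.trans ?_
      rw [Finset.sum_add_distrib, Finset.sum_ite_eq' Finset.univ x]
      simp only [Finset.mem_univ, if_true]
      rw [← Finset.sum_filter, Finset.sum_const, nsmul_eq_mul]
      have : ((Finset.univ.filter fun v => c v = c x).card : ℝ) ≤ M := by exact_mod_cast hfib _
      have : 0 ≤ δ ^ 2 / 8 * N := by positivity
      gcongr
    refine (Finset.sum_le_sum fun x _ => e2 x).trans ?_
    rw [Finset.sum_const, nsmul_eq_mul, Finset.card_univ]
    refine le_of_eq ?_
    ring
  have hK' : K * M ≤ 2 * n := by simp only [K, n]; exact_mod_cast hK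
  have hK0 : 0 ≤ K := by positivity
  have hM0 : (0 : ℝ) < M := by
    by_contra h
    have : (M : ℝ) = 0 := le_antisymm (not_lt.mp h) (by positivity)
    rw [this] at hM; linarith
  have h1 : (δ * (n * N)) ^ 2 ≤ N * (K * (n * N + n * M * (δ ^ 2 / 8 * N))) := by
    refine (pow_le_pow_left₀ (by positivity) hR 2).trans (hcs.trans ?_)
    gcongr
  have h2 : (δ * (n * N)) ^ 2 * M ≤ 2 * n * (N * (n * N + n * M * (δ ^ 2 / 8 * N))) := by
    calc (δ * (n * N)) ^ 2 * M ≤ N * (K * (n * N + n * M * (δ ^ 2 / 8 * N))) * M := by gcongr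
      _ = K * M * (N * (n * N + n * M * (δ ^ 2 / 8 * N))) := by ring
      _ ≤ _ := by gcongr
  have h3 : (n * N) ^ 2 * (δ ^ 2 * M) ≤ (n * N) ^ 2 * (2 + δ ^ 2 * M / 4) := by
    calc _ = (δ * (n * N)) ^ 2 * M := by ring
      _ ≤ _ := h2
      _ = _ := by ring
  have h4 := le_of_mul_le_mul_left h3 (by positivity)
  linarith

/-- A dense family of `k`-tuples contains a doubled tuple (a complete `k`-partite pattern with two
entries per coordinate) in which the two entries of each coordinate have the same colour. -/
lemma exists_doubled_tuple_fin (k : ℕ) : ∀ δ : ℝ, 0 < δ → ∃ M₀ : ℕ, ∀ M, M₀ ≤ M →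
    ∀ (V : Type) [Fintype V] (c pos : V → ℕ), Function.Injective pos → 0 < Fintype.card V →
    (∀ a, (Finset.univ.filter fun v => c v = a).card ≤ M) →
    (Finset.univ.image c).card * M ≤ 2 * Fintype.card V →
    ∀ F : Finset (Fin k → V), δ * (Fintype.card V : ℝ) ^ k ≤ (F.card : ℝ) →
    ∃ e : Fin k → Bool → V,
      (∀ i, c (e i false) = c (e i true) ∧ pos (e i false) < pos (e i true)) ∧
      ∀ ε : Fin k → Bool, (fun i => e i (ε i)) ∈ F := by
  induction k with
  | zero =>
    intro δ hδ
    refine ⟨0, fun M _ V _ c pos _ _ _ _ F hF => ?_⟩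
    have hF0 : 0 < F.card := by
      have : (0 : ℝ) < F.card := lt_of_lt_of_le (by simpa using hδ) hF
      exact_mod_cast this
    obtain ⟨f, hf⟩ := Finset.card_pos.mp hF0
    exact ⟨fun i => i.elim0, fun i => i.elim0, fun ε => by
      convert hf using 1⟩
  | succ k ih =>
    intro δ hδ
    obtain ⟨M₁, hM₁⟩ := ih (δ ^ 2 / 8) (by positivity)
    obtain ⟨M₂, hM₂⟩ := exists_nat_ge (4 / δ ^ 2)
    refine ⟨max M₁ M₂, fun M hM V _ c pos hpos hV hfib hK F hF => ?_⟩
    have hM' : 4 ≤ δ ^ 2 * M := by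
      have : (M₂ : ℝ) ≤ M := by exact_mod_cast (le_max_right _ _).trans hM
      have := hM₂.trans this
      rw [div_le_iff₀ (by positivity)] at this
      linarith
    have hcard : F.card = ∑ y : Fin k → V, (Finset.univ.filter fun x : V =>
        (Fin.cons x y : Fin (k + 1) → V) ∈ F).card := by
      rw [Finset.card_eq_sum_card_fiberwise (f := fun g => Fin.tail g) (t := Finset.univ)
        (fun _ _ => by simp)]
      refine Finset.sum_congr rfl fun y _ => ?_
      refine Finset.card_bij' (fun g _ => g 0)
        (fun x _ => (Fin.cons x y : Fin (k + 1) → V)) ?_ ?_ ?_ ?_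
      · intro g hg
        simp only [Finset.mem_filter, Finset.mem_univ, true_and] at hg ⊢
        rw [← hg.2, Fin.cons_self_tail]; exact hg.1
      · intro x hx
        simp only [Finset.mem_filter, Finset.mem_univ, true_and] at hx ⊢
        exact ⟨hx, Fin.tail_cons _ _⟩
      · intro g hg
        simp only [Finset.mem_filter] at hg
        rw [← hg.2, Fin.cons_self_tail]
      · intro x _
        rfl
    obtain ⟨x, x', hc, hp, hl⟩ := exists_pair_large_common c pos hpos M δ hδ hM' hfib hK
      (fun x (y : Fin k → V) => (Fin.cons x y : Fin (k + 1) → V) ∈ F) hV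
      (by rw [Fintype.card_fun]; exact pow_pos hV _) (by
        rw [Fintype.card_fun, Fintype.card_fin]
        push_cast
        rw [← pow_succ']
        rw [hcard] at hF
        refine hF.trans (le_of_eq ?_)
        push_cast
        refine Finset.sum_congr rfl fun y _ => ?_
        congr)
    obtain ⟨e, he1, he2⟩ := hM₁ M ((le_max_left _ _).trans hM) V c pos hpos hV hfib hK _ (by
        rw [Fintype.card_fun, Fintype.card_fin] at hl
        push_cast at hl
        exact hl)
    refine ⟨Fin.cons (fun b => if b then x' else x) e, ?_, ?_⟩
    · intro i
      refine Fin.cases ?_ (fun j => ?_) i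
      · simp [hc, hp]
      · simpa using he1 j
    · intro ε
      have := he2 (fun i => ε i.succ)
      simp only [Finset.mem_filter, Finset.mem_univ, true_and] at this
      have e3 : (fun i => (Fin.cons (fun b => if b then x' else x) e : Fin (k + 1) → Bool → V) i
          (ε i)) = Fin.cons (if ε 0 then x' else x) (fun i => e i (ε i.succ)) := by
        funext i
        refine Fin.cases ?_ (fun j => ?_) i
        · simp
        · simp
      rw [e3]
      cases ε 0
      · simpa using this.1
      · simpa using this.2

lemma exists_doubled_tuple (ι : Type) [Fintype ι] (δ : ℝ) (hδ : 0 < δ) : ∃ M₀ : ℕ, ∀ M, M₀ ≤ M →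
    ∀ (V : Type) [Fintype V] (c pos : V → ℕ), Function.Injective pos → 0 < Fintype.card V →
    (∀ a, (Finset.univ.filter fun v => c v = a).card ≤ M) →
    (Finset.univ.image c).card * M ≤ 2 * Fintype.card V →
    ∀ F : Finset (ι → V), δ * (Fintype.card V : ℝ) ^ Fintype.card ι ≤ (F.card : ℝ) →
    ∃ e : ι → Bool → V,
      (∀ i, c (e i false) = c (e i true) ∧ pos (e i false) < pos (e i true)) ∧
      ∀ ε : ι → Bool, (fun i => e i (ε i)) ∈ F := by
  obtain ⟨M₀, h⟩ := exists_doubled_tuple_fin (Fintype.card ι) δ hδ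
  refine ⟨M₀, fun M hM V _ c pos hpos hV hfib hK F hF => ?_⟩
  let φ := Fintype.equivFin ι
  obtain ⟨e, he1, he2⟩ := h M hM V c pos hpos hV hfib hK
    (F.map (Equiv.arrowCongr φ (Equiv.refl V)).toEmbedding) (by rwa [Finset.card_map])
  refine ⟨fun i => e (φ i), fun i => he1 _, fun ε => ?_⟩
  have := he2 (fun i => ε (φ.symm i))
  rw [Finset.mem_map] at this
  obtain ⟨g, hg, hg2⟩ := this
  convert hg using 1
  funext i
  have := congrFun hg2 (φ i)
  simpa using this.symm

/-- Counting functions one of whose values is confined to a small set that depends on the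
others. -/
lemma card_filter_apply_mem_le {ι V : Type*} [Fintype ι] [DecidableEq ι] [Fintype V] (i : ι)
    (Q : (ι → V) → Finset V) (m : ℕ) (hQ : ∀ f v, Q (Function.update f i v) = Q f)
    (hm : ∀ f, (Q f).card ≤ m) :
    (Finset.univ.filter fun f : ι → V => f i ∈ Q f).card * Fintype.card V ≤
      m * Fintype.card V ^ Fintype.card ι := by
  have h1 : (Finset.univ.filter fun f : ι → V => f i ∈ Q f).card * Fintype.card V =
      ((Finset.univ.filter fun f : ι → V => f i ∈ Q f) ×ˢ (Finset.univ : Finset V)).card := by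
    rw [Finset.card_product, Finset.card_univ]
  have h2 : ((Finset.univ.filter fun f : ι → V => f i ∈ Q f) ×ˢ (Finset.univ : Finset V)).card ≤
      ((Finset.univ : Finset (ι → V)).sigma Q).card := by
    refine Finset.card_le_card_of_injOn (fun p => ⟨Function.update p.1 i p.2, p.1 i⟩) ?_ ?_
    · rintro ⟨f, v⟩ h
      simp only [Finset.coe_product, Set.mem_prod, Finset.mem_coe, Finset.mem_filter,
        Finset.mem_univ, true_and] at h
      simp only [Finset.mem_coe, Finset.mem_sigma, Finset.mem_univ, true_and, hQ]
      exact h.1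
    · rintro ⟨f, v⟩ _ ⟨g, u⟩ _ h
      simp only [Sigma.mk.injEq, heq_eq_eq] at h
      obtain ⟨h1, h2⟩ := h
      have h3 : v = u := by simpa using congrFun h1 i
      have h4 : f = g := by
        funext j
        by_cases hj : j = i
        · subst hj; exact h2
        · simpa [hj] using congrFun h1 j
      rw [h3, h4]
  rw [h1]
  refine h2.trans ?_
  rw [Finset.card_sigma]
  refine (Finset.sum_le_sum fun f _ => hm f).trans ?_
  rw [Finset.sum_const, Finset.card_univ, Fintype.card_fun, smul_eq_mul, mul_comm]

end Doubling

section Fix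

lemma IsFullCycle.bijective_pow {V : Type*} [Fintype V] {σ : Equiv.Perm V} (hσ : IsFullCycle σ)
    (a : V) : Function.Bijective (fun i : Fin (Fintype.card V) => (σ ^ (i : ℕ)) a) := by
  rw [Fintype.bijective_iff_surjective_and_card]
  refine ⟨fun v => ?_, by simp⟩
  by_cases ha : σ a = a
  · have : v = a := by
      obtain ⟨i, hi⟩ := hσ a v
      rw [← hi, Equiv.Perm.zpow_apply_eq_self_of_apply_eq_self ha]
    exact ⟨⟨0, Fintype.card_pos_iff.mpr ⟨a⟩⟩, by simp [this]⟩
  · obtain ⟨i, hi, h⟩ := (hσ a v).exists_pow_eq_of_mem_support (by simpa using ha)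
    exact ⟨⟨i, hi.trans_le (Finset.card_le_univ _)⟩, h⟩

/-- Discarding the members of a family of functions for which one of finitely many local conditions
fails. -/
lemma card_mul_le_card_filter_avoid {ι V κ : Type*} [Fintype ι] [DecidableEq ι] [Fintype V]
    [Fintype κ] (F : Finset (ι → V)) (p : κ → ι) (Q : κ → (ι → V) → Finset V) (m : ℕ)
    (hQ : ∀ k f v, Q k (Function.update f (p k) v) = Q k f) (hm : ∀ k f, (Q k f).card ≤ m) :
    F.card * Fintype.card V ≤ (F.filter fun f => ∀ k, f (p k) ∉ Q k f).card * Fintype.card V +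
      Fintype.card κ * m * Fintype.card V ^ Fintype.card ι := by
  have h1 : F ⊆ (F.filter fun f => ∀ k, f (p k) ∉ Q k f) ∪
      Finset.univ.biUnion fun k => Finset.univ.filter fun f : ι → V => f (p k) ∈ Q k f := by
    intro f hf
    by_cases h : ∀ k, f (p k) ∉ Q k f
    · exact Finset.mem_union_left _ (Finset.mem_filter.mpr ⟨hf, h⟩)
    · push Not at h
      obtain ⟨k, hk⟩ := h
      exact Finset.mem_union_right _ (by
        rw [Finset.mem_biUnion]; exact ⟨k, Finset.mem_univ _, by simpa using hk⟩)
  have h2 := (Finset.card_le_card h1).trans (Finset.card_union_le _ _)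
  refine (Nat.mul_le_mul_right _ h2).trans ?_
  rw [add_mul]
  refine Nat.add_le_add_left ?_ _
  refine (Nat.mul_le_mul_right _ Finset.card_biUnion_le).trans ?_
  rw [Finset.sum_mul]
  refine (Finset.sum_le_sum fun k _ => card_filter_apply_mem_le (p k) (Q k) m (hQ k) (hm k)).trans ?_
  rw [Finset.sum_const, Finset.card_univ, smul_eq_mul, mul_assoc]

/-- `w` lists the inner vertices of a walk with five edges from `x` to `y`. -/
def IsWalkFive {V : Type*} (A : V → V → Prop) (x : V) (w : Fin 4 → V) (y : V) : Prop :=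
  A x (w 0) ∧ A (w 0) (w 1) ∧ A (w 1) (w 2) ∧ A (w 2) (w 3) ∧ A (w 3) y

/-- The cyclic successor on `Fin 5 × Fin 5` in lexicographic order. -/
def lexSucc : Equiv.Perm (Fin 5 × Fin 5) where
  toFun i := if i.2 = 4 then (i.1 + 1, 0) else (i.1, i.2 + 1)
  invFun i := if i.2 = 0 then (i.1 - 1, 4) else (i.1, i.2 - 1)
  left_inv := by decide
  right_inv := by decide

lemma lexSucc_ne : ∀ i, lexSucc i ≠ i := by decide

lemma lexSucc_induction (P : Fin 5 × Fin 5 → Prop) (h : ∀ i, P i → P (lexSucc i)) (i j)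
    (hi : P i) : P j := by
  have h0 : ∀ m : ℕ, ∀ i, P i → P (lexSucc^[m] i) := by
    intro m
    induction m with
    | zero => exact fun i hi => hi
    | succ m ih => exact fun i hi => ih _ (h i hi)
  have h1 : ∀ i, ∃ m : Fin 25, lexSucc^[(m : ℕ)] i = (0, 0) := by decide +kernel
  have h2 : ∀ i, ∃ m : Fin 25, lexSucc^[(m : ℕ)] (0, 0) = i := by decide +kernel
  obtain ⟨m, hm⟩ := h1 i
  obtain ⟨m', hm'⟩ := h2 j
  have := h0 m i hi
  rw [hm] at this
  have := h0 m' _ this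
  rwa [hm'] at this

lemma IsWalkFive.step {V : Type*} {A : V → V → Prop} {a : Fin 5 → V} {g : Fin 5 → Fin 4 → V}
    (h : ∀ j, IsWalkFive A (a j) (g j) (a (j + 1))) (i : Fin 5 × Fin 5) :
    A ((Fin.cons (a i.1) (g i.1) : Fin 5 → V) i.2)
      ((Fin.cons (a (lexSucc i).1) (g (lexSucc i).1) : Fin 5 → V) (lexSucc i).2) := by
  obtain ⟨j, l⟩ := i
  obtain ⟨h1, h2, h3, h4, h5⟩ := h j
  fin_cases l
  · exact h1
  · exact h2
  · exact h3
  · exact h4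
  · exact h5

/-- The number of closed walks on `Fin 5 × Fin 5` whose five base vertices lie in
prescribed sets. -/
lemma pow_le_card_closed_walk {V : Type*} [Fintype V] (A : V → V → Prop) (J : Fin 5 → Finset V)
    (D w : ℝ) (hD : 0 ≤ D) (hw : 0 ≤ w)
    (hJ : ∀ j, D ≤ (J j).card)
    (hA : ∀ x y, w ≤ ((Finset.univ.filter fun g : Fin 4 → V => IsWalkFive A x g y).card : ℝ)) :
    D ^ 5 * w ^ 5 ≤ ((Finset.univ.filter fun f : Fin 5 × Fin 5 → V =>
      (∀ j, f (j, 0) ∈ J j) ∧ ∀ i, A (f i) (f (lexSucc i))).card : ℝ) := by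
  let S := (Fintype.piFinset J).sigma fun a => Fintype.piFinset fun j =>
    Finset.univ.filter fun g : Fin 4 → V => IsWalkFive A (a j) g (a (j + 1))
  have hS : D ^ 5 * w ^ 5 ≤ (S.card : ℝ) := by
    rw [Finset.card_sigma]
    push_cast
    have : ∀ a ∈ Fintype.piFinset J, w ^ 5 ≤ ((Fintype.piFinset fun j =>
        Finset.univ.filter fun g : Fin 4 → V => IsWalkFive A (a j) g (a (j + 1))).card : ℝ) := by
      intro a _
      rw [Fintype.card_piFinset]
      push_cast
      calc w ^ 5 = ∏ _j : Fin 5, w := by simp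
        _ ≤ _ := Finset.prod_le_prod (fun _ _ => hw) fun j _ => hA _ _
    refine le_trans ?_ (Finset.sum_le_sum this)
    rw [Finset.sum_const, nsmul_eq_mul, Fintype.card_piFinset]
    push_cast
    refine mul_le_mul_of_nonneg_right ?_ (by positivity)
    calc D ^ 5 = ∏ _j : Fin 5, D := by simp
        _ ≤ _ := Finset.prod_le_prod (fun _ _ => hD) fun j _ => hJ _
  refine hS.trans ?_
  norm_cast
  refine Finset.card_le_card_of_injOn
    (fun p i => (Fin.cons (p.1 i.1) (p.2 i.1) : Fin 5 → V) i.2) ?_ ?_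
  · rintro ⟨a, g⟩ h
    simp only [S, Finset.mem_coe, Finset.mem_sigma, Fintype.mem_piFinset, Finset.mem_filter,
      Finset.mem_univ, true_and] at h ⊢
    exact ⟨fun j => h.1 j, IsWalkFive.step h.2⟩
  · rintro ⟨a, g⟩ _ ⟨a', g'⟩ _ h
    have h1 : a = a' := by
      funext j
      exact congrFun h (j, 0)
    have h2 : g = g' := by
      funext j l
      exact congrFun h (j, l.succ)
    rw [h1, h2]

end Fix

section FixChain

lemma exists_closed_walk_separated {V : Type*} [Fintype V] (σ : Equiv.Perm V) (A : V → V → Prop)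
    (x : V) (E : Finset V) (D : ℕ)
    (h : 20 * (2 * (D + 1) + E.card) * Fintype.card V ^ 4 <
      (Finset.univ.filter fun w : Fin 4 → V => IsWalkFive A x w x).card * Fintype.card V) :
    ∃ a : Fin 5 → V, a 0 = x ∧ (∀ j, A (a j) (a (j + 1))) ∧ (∀ j, j ≠ 0 → a j ∉ E) ∧
      ∀ i j, i ≠ j → ∀ k ≤ D, (σ ^ k) (a i) ≠ a j := by
  let N : V → Finset V := fun b => (Finset.range (D + 1)).image (fun k => (σ ^ k) b) ∪
    (Finset.range (D + 1)).image (fun k => (σ ^ k)⁻¹ b)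
  have hN : ∀ b, (N b).card ≤ 2 * (D + 1) := by
    intro b
    refine (Finset.card_union_le _ _).trans ?_
    have h1 := Finset.card_image_le (s := Finset.range (D + 1)) (f := fun k => (σ ^ k) b)
    have h2 := Finset.card_image_le (s := Finset.range (D + 1)) (f := fun k => (σ ^ k)⁻¹ b)
    rw [Finset.card_range] at h1 h2
    omega
  have hN1 : ∀ b c, c ∉ N b → ∀ k ≤ D, (σ ^ k) b ≠ c ∧ (σ ^ k) c ≠ b := by
    intro b c hc k hk
    constructor
    · rintro rfl
      exact hc (Finset.mem_union_left _ (Finset.mem_image.mpr ⟨k, by simp; omega, rfl⟩))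
    · rintro rfl
      exact hc (Finset.mem_union_right _ (Finset.mem_image.mpr ⟨k, by simp; omega, by simp⟩))
  let Q : Fin 4 × Option (Fin 4) → (Fin 4 → V) → Finset V := fun k w =>
    match k.2 with
    | none => N x ∪ E
    | some m => if m = k.1 then ∅ else N (w m)
  have key := card_mul_le_card_filter_avoid
    (Finset.univ.filter fun w : Fin 4 → V => IsWalkFive A x w x) (fun k => k.1) Q
    (2 * (D + 1) + E.card) (by
      rintro ⟨l, _ | m⟩ f v
      · rfl
      · by_cases hm : m = l
        · simp [Q, hm]
        · simp [Q, hm]) (by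
      rintro ⟨l, _ | m⟩ f
      · exact (Finset.card_union_le _ _).trans (Nat.add_le_add_right (hN x) _)
      · by_cases hm : m = l
        · simp [Q, hm]
        · simp only [Q, hm, if_false]
          exact (hN _).trans (Nat.le_add_right _ _))
  simp only [Fintype.card_prod, Fintype.card_fin, Fintype.card_option] at key
  have hpos : 0 < ((Finset.univ.filter fun w : Fin 4 → V => IsWalkFive A x w x).filter
      fun f => ∀ k : Fin 4 × Option (Fin 4), f k.1 ∉ Q k f).card := by
    by_contra h0
    rw [not_lt, Nat.le_zero] at h0
    rw [h0] at key
    linarith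
  obtain ⟨w, hw⟩ := Finset.card_pos.mp hpos
  simp only [Finset.mem_filter, Finset.mem_univ, true_and] at hw
  obtain ⟨⟨h1, h2, h3, h4, h5⟩, hw⟩ := hw
  have hx : ∀ l, w l ∉ N x ∧ w l ∉ E := by
    intro l
    have := hw (l, none)
    simpa [Q] using this
  have hm : ∀ l m, m ≠ l → w l ∉ N (w m) := by
    intro l m hlm
    have := hw (l, some m)
    simpa [Q, hlm] using this
  refine ⟨Fin.cons x w, rfl, ?_, ?_, ?_⟩
  · intro j
    fin_cases j
    · exact h1
    · exact h2
    · exact h3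
    · exact h4
    · exact h5
  · intro j hj
    induction j using Fin.cases with
    | zero => exact absurd rfl hj
    | succ l => exact (hx l).2
  · intro i j hij k hk
    induction i using Fin.cases with
    | zero =>
      induction j using Fin.cases with
      | zero => exact absurd rfl hij
      | succ l => exact (hN1 x (w l) (hx l).1 k hk).1
    | succ m =>
      induction j using Fin.cases with
      | zero => exact (hN1 x (w m) (hx m).1 k hk).2
      | succ l => exact (hN1 (w m) (w l) (hm l m (fun h => hij (by rw [h]))) k hk).1

/-- Blocks of `M` consecutive positions along a full cycle. -/
lemma exists_position {V : Type*} [Fintype V] {σ : Equiv.Perm V} (hσ : IsFullCycle σ) (x : V) :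
    ∃ pos : V → ℕ, Function.Injective pos ∧ (∀ v, pos v < Fintype.card V) ∧
      (∀ v, (σ ^ pos v) x = v) ∧ ∀ i < Fintype.card V, pos ((σ ^ i) x) = i := by
  let φ := Equiv.ofBijective _ (hσ.bijective_pow x)
  have h1 : ∀ v, (σ ^ (φ.symm v : ℕ)) x = v := fun v => φ.apply_symm_apply v
  refine ⟨fun v => φ.symm v, ?_, fun v => (φ.symm v).2, h1, ?_⟩
  · intro u v h
    exact φ.symm.injective (Fin.ext h)
  · intro i hi
    have : φ.symm (φ ⟨i, hi⟩) = ⟨i, hi⟩ := φ.symm_apply_apply _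
    exact congrArg Fin.val this

lemma block_bounds {V : Type*} [Fintype V] (pos : V → ℕ) (hpos : Function.Injective pos)
    (hlt : ∀ v, pos v < Fintype.card V) (M : ℕ) (hM : 0 < M) (hMn : M ≤ Fintype.card V) :
    (∀ a, (Finset.univ.filter fun v => pos v / M = a).card ≤ M) ∧
      (Finset.univ.image fun v => pos v / M).card * M ≤ 2 * Fintype.card V := by
  constructor
  · intro a
    have : (Finset.univ.filter fun v => pos v / M = a).card ≤
        (Finset.Ico (a * M) (a * M + M)).card := by
      refine Finset.card_le_card_of_injOn pos ?_ (fun _ _ _ _ h => hpos h)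
      intro v hv
      simp only [Finset.coe_filter, Finset.mem_univ, true_and, Set.mem_ofPred_eq] at hv
      simp only [Finset.coe_Ico, Set.mem_Ico]
      have h1 := Nat.mod_lt (pos v) hM
      have h2 := Nat.zero_le (pos v % M)
      have := Nat.div_add_mod (pos v) M
      rw [hv, mul_comm] at this
      constructor <;> linarith
    simpa using this
  · have : (Finset.univ.image fun v => pos v / M) ⊆
        Finset.range ((Fintype.card V - 1) / M + 1) := by
      intro a ha
      simp only [Finset.mem_image, Finset.mem_univ, true_and] at ha
      obtain ⟨v, rfl⟩ := ha
      rw [Finset.mem_range, Nat.lt_succ_iff]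
      exact Nat.div_le_div_right (by have := hlt v; omega)
    have := Finset.card_le_card this
    rw [Finset.card_range] at this
    refine (Nat.mul_le_mul_right _ this).trans ?_
    have := Nat.div_mul_le_self (Fintype.card V - 1) M
    rw [add_mul]
    omega

end FixChain

section FixMain

/-- Rewiring a full cycle along a separated closed walk, given a doubled closed walk whose entries
sit in private blocks. -/
lemma exists_isFullCycle_of_doubled {V : Type*} [Fintype V] [DecidableEq V]
    {σ : Equiv.Perm V} (hσ : IsFullCycle σ)
    (A : V → V → Prop) (D M : ℕ) (hD : D < Fintype.card V) (x : V) (pos : V → ℕ)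
    (hlt : ∀ v, pos v < Fintype.card V)
    (hp1 : ∀ v, (σ ^ pos v) x = v) (hp2 : ∀ i < Fintype.card V, pos ((σ ^ i) x) = i)
    (a : Fin 5 → V) (haA : ∀ j, A (a j) (a (j + 1)))
    (hsep : ∀ i j, i ≠ j → ∀ k ≤ D, (σ ^ k) (a i) ≠ a j)
    (e : Fin 5 × Fin 5 → Bool → V)
    (he1 : ∀ i, pos (e i false) / M = pos (e i true) / M ∧ pos (e i false) < pos (e i true))
    (he2 : ∀ i j b b', i ≠ j → pos (e i b) / M ≠ pos (e j b') / M)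
    (he3 : ∀ i j b, pos (e i b) / M ≠ pos (a j) / M)
    (he4 : ∀ i b b', A (e i b) (e (lexSucc i) b'))
    (he5 : ∀ j, ∃ k, 1 ≤ k ∧ k ≤ D ∧ (σ ^ k) (a j) = e (j, 0) false) :
    ∃ τ : Equiv.Perm V, ∃ Z : Finset V, IsFullCycle τ ∧ Z.card ≤ 55 ∧ a 0 ∈ Z ∧
      (∀ z ∉ Z, τ z = σ z) ∧ (∀ z ∈ Z, ∃ y, τ z = σ y ∧ A z y) ∧
      ∀ z ∈ Z, (∃ j, z = a j) ∨ ∃ i b, z = e i b := by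
  have hstep : ∀ m v, (σ ^ m) v = (σ ^ (m + pos v)) x := by
    intro m v
    rw [pow_add, Equiv.Perm.mul_apply, hp1]
  let f : ((Fin 5 × Fin 5) × Bool) ⊕ Fin 5 → V := Sum.elim (fun p => e p.1 p.2) a
  have hf : Function.Injective f := by
    refine Function.Injective.sumElim ?_ ?_ ?_
    · rintro ⟨i, b⟩ ⟨j, b'⟩ h
      simp only at h
      by_cases hij : i = j
      · subst hij
        have := (he1 i).2
        cases b <;> cases b' <;> first | rfl | (rw [h] at this; omega)
      · exact absurd (by rw [h]) (he2 i j b b' hij)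
    · intro i j h
      by_contra hij
      exact hsep i j hij 0 (Nat.zero_le _) h
    · rintro ⟨i, b⟩ j h
      simp only at h
      exact he3 i j b (by rw [h])
  obtain ⟨τ, h1, h2, h3, h4⟩ := exists_isFullCycle_rewire σ hσ lexSucc (finRotate 5)
    lexSucc_induction f hf (by
      intro i
      obtain ⟨h1, h2⟩ := he1 i
      refine ⟨pos (e i true) - pos (e i false), by omega, ?_, ?_⟩
      · show (σ ^ _) (e i false) = e i true
        rw [hstep, Nat.sub_add_cancel h2.le, hp1]
      · rintro m hm0 hm ⟨y, hy⟩
        have h3 : pos (f y) = m + pos (e i false) := by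
          rw [hy]
          show pos ((σ ^ m) (e i false)) = _
          rw [hstep, hp2]
          have := hlt (e i true)
          omega
        have h4 : pos (f y) / M = pos (e i false) / M := by
          apply le_antisymm
          · rw [h1]; exact Nat.div_le_div_right (by omega)
          · exact Nat.div_le_div_right (by omega)
        rcases y with ⟨i', b⟩ | j
        · by_cases hi : i' = i
          · subst hi
            cases b
            · change pos (e i' false) = _ at h3
              omega
            · change pos (e i' true) = _ at h3
              omega
          · exact he2 i' i b false hi h4
        · exact he3 i j false h4.symm) (by
      intro j
      have hex : ∃ d, 1 ≤ d ∧ (σ ^ d) (a j) ∈ Set.range f := by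
        obtain ⟨k, hk1, _, hk3⟩ := he5 j
        exact ⟨k, hk1, .inl ((j, 0), false), hk3.symm⟩
      have hle : Nat.find hex ≤ D := by
        obtain ⟨k, hk1, hk2, hk3⟩ := he5 j
        exact (Nat.find_min' hex ⟨hk1, .inl ((j, 0), false), hk3.symm⟩).trans hk2
      obtain ⟨hd1, y, hy⟩ := Nat.find_spec hex
      refine ⟨Nat.find hex, hd1, ?_, ?_⟩
      · rcases y with y | j'
        · exact ⟨y, hy.symm⟩
        · exfalso
          by_cases hj : j = j'
          · subst hj
            have h0 := (hσ.bijective_pow (a j)).1 (a₁ := ⟨Nat.find hex, by omega⟩)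
              (a₂ := ⟨0, by omega⟩) hy.symm
            have := congrArg Fin.val h0
            simp only at this
            omega
          · exact hsep j j' hj _ hle hy.symm
      · intro m hm hm' hr
        exact Nat.find_min hex hm' ⟨hm, hr⟩)
  refine ⟨τ, Finset.univ.image f, h1, ?_, ?_, ?_, ?_, ?_⟩
  · exact Finset.card_image_le.trans (by simp)
  · exact Finset.mem_image.mpr ⟨.inr 0, Finset.mem_univ _, rfl⟩
  · intro z hz
    refine h2 z fun ⟨y, hy⟩ => hz (Finset.mem_image.mpr ⟨y, Finset.mem_univ _, hy⟩)
  · intro z hz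
    obtain ⟨y, _, rfl⟩ := Finset.mem_image.mp hz
    rcases y with ⟨i, b⟩ | j
    · obtain ⟨b', hb⟩ := h3 i b
      exact ⟨_, hb, he4 i b b'⟩
    · refine ⟨_, h4 j, ?_⟩
      have := haA j
      rw [finRotate_apply]
      exact this
  · intro z hz
    obtain ⟨y, _, rfl⟩ := Finset.mem_image.mp hz
    rcases y with ⟨i, b⟩ | j
    · exact .inr ⟨i, b, rfl⟩
    · exact .inl ⟨j, rfl⟩

lemma half_density_le_of_avoid {F F' E M n : ℕ} {δ₀ : ℝ} (hn : (0 : ℝ) < n)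
    (key : F * n ≤ F' * n + 650 * (E + 5 * M) * n ^ 25) (hF : δ₀ * (n : ℝ) ^ 25 ≤ F)
    (h : 650 * (E + 5 * M : ℝ) ≤ δ₀ / 2 * n) : δ₀ / 2 * (n : ℝ) ^ (5 * 5) ≤ F' := by
  have k1 : (F : ℝ) * n ≤ F' * n + 650 * (E + 5 * M) * n ^ 25 := by exact_mod_cast key
  have k4 : 650 * (E + 5 * M : ℝ) * n ^ 25 ≤ δ₀ / 2 * n * n ^ 25 := by gcongr
  have k5 : δ₀ * n ^ 25 * n ≤ F * n := by gcongr
  have k6 : δ₀ / 2 * n ^ 25 * n ≤ F' * n := by linarith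
  exact le_of_mul_le_mul_right k6 hn

/-- A relation supporting many closed walks allows us to give any vertex of a full cycle a new
out-edge from the relation, changing a bounded number of edges and avoiding small forbidden sets. -/
lemma exists_isFullCycle_fix (c : ℝ) (hc : 0 < c) : ∃ c₃ : ℝ, 0 < c₃ ∧ ∃ n₀ : ℕ,
    ∀ (V : Type) [Fintype V] [DecidableEq V], n₀ ≤ Fintype.card V → ∀ H : V → V → Prop,
    (∀ (σ : Equiv.Perm V) (x y : V), c * (Fintype.card V : ℝ) ^ 4 ≤
      ((Finset.univ.filter fun w : Fin 4 → V =>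
        IsWalkFive (fun a b => H a (σ b)) x w y).card : ℝ)) →
    ∀ Dp Dm : Finset V, (Dp.card : ℝ) ≤ c₃ * Fintype.card V →
      (Dm.card : ℝ) ≤ c₃ * Fintype.card V →
    ∀ σ : Equiv.Perm V, IsFullCycle σ → ∀ x, ∃ τ : Equiv.Perm V, ∃ Z : Finset V,
      IsFullCycle τ ∧ Z.card ≤ 55 ∧ x ∈ Z ∧ (∀ z ∉ Z, τ z = σ z) ∧ (∀ z ∈ Z, H z (τ z)) ∧
      ∀ z ∈ Z, z ≠ x → z ∉ Dp ∧ σ z ∉ Dm := by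
  set δ₀ : ℝ := (c / 400 * c) ^ 5 with hδ₀
  have hδ₀p : 0 < δ₀ := by positivity
  obtain ⟨M₀, hM₀⟩ := exists_doubled_tuple (Fin 5 × Fin 5) (δ₀ / 2) (by positivity)
  set M := M₀ + 1 with hMdef
  obtain ⟨N₁, hN₁⟩ := exists_nat_ge (400 / c)
  obtain ⟨N₂, hN₂⟩ := exists_nat_ge (13000 * M / δ₀)
  refine ⟨min (c / 400) (δ₀ / 5200), by positivity, N₁ + N₂ + M + 1, ?_⟩
  intro V _ _ hn H hW Dp Dm hDp hDm σ hσ x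
  set n := Fintype.card V with hndef
  have hn0 : (0 : ℝ) < n := by
    have : 0 < n := by omega
    exact_mod_cast this
  have hn1 : 400 ≤ c * n := by
    have h : (N₁ : ℝ) ≤ n := by exact_mod_cast (by omega : N₁ ≤ n)
    have := hN₁.trans h
    rw [div_le_iff₀ hc] at this
    linarith
  have hn2 : 13000 * M ≤ δ₀ * n := by
    have h : (N₂ : ℝ) ≤ n := by exact_mod_cast (by omega : N₂ ≤ n)
    have := hN₂.trans h
    rw [div_le_iff₀ hδ₀p] at this
    linarith
  have hc1 : c ≤ 1 := by
    have h1 := hW σ x x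
    have h2 : ((Finset.univ.filter fun w : Fin 4 → V =>
        IsWalkFive (fun a b => H a (σ b)) x w x).card : ℝ) ≤ (n : ℝ) ^ 4 := by
      have := Finset.card_le_univ (Finset.univ.filter fun w : Fin 4 → V =>
        IsWalkFive (fun a b => H a (σ b)) x w x)
      rw [Fintype.card_fun, Fintype.card_fin] at this
      exact_mod_cast this
    have h3 := h1.trans h2
    have : (0 : ℝ) < (n : ℝ) ^ 4 := by positivity
    by_contra hcon
    nlinarith
  set A : V → V → Prop := fun a b => H a (σ b) with hA
  set E : Finset V := Dp ∪ Finset.univ.filter fun v => σ v ∈ Dm with hE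
  have hEcard : E.card ≤ Dp.card + Dm.card := by
    refine (Finset.card_union_le _ _).trans (Nat.add_le_add_left ?_ _)
    refine Finset.card_le_card_of_injOn σ ?_ (σ.injective.injOn)
    intro v hv
    simpa using hv
  have hEr : (E.card : ℝ) ≤ Dp.card + Dm.card := by exact_mod_cast hEcard
  have hmin1 : min (c / 400) (δ₀ / 5200) * (n : ℝ) ≤ c / 400 * n :=
    mul_le_mul_of_nonneg_right (min_le_left _ _) hn0.le
  have hmin2 : min (c / 400) (δ₀ / 5200) * (n : ℝ) ≤ δ₀ / 5200 * n :=
    mul_le_mul_of_nonneg_right (min_le_right _ _) hn0.le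
  set D := ⌊c / 200 * n⌋₊ with hD
  have hD1 : (D : ℝ) ≤ c / 200 * n := Nat.floor_le (by positivity)
  have hD2 : c / 400 * n ≤ D := by
    have := Nat.lt_floor_add_one (c / 200 * n)
    rw [← hD] at this
    linarith
  have hDn : D < n := by
    have : (D : ℝ) < n := by nlinarith
    exact_mod_cast this
  obtain ⟨a, ha0, haA, haE, hsep⟩ := exists_closed_walk_separated σ A x E D (by
    have h1 := hW σ x x
    have h2 : (20 * (2 * (D + 1) + E.card) * n ^ 4 : ℝ) <
      (Finset.univ.filter fun w : Fin 4 → V => IsWalkFive A x w x).card * n := by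
      have h3 : (20 * (2 * (D + 1) + E.card) : ℝ) < c * n := by linarith
      have h4 : (0 : ℝ) < (n : ℝ) ^ 4 := by positivity
      calc (20 * (2 * (D + 1) + E.card) * n ^ 4 : ℝ) < c * n * n ^ 4 := by gcongr
        _ = c * n ^ 4 * n := by ring
        _ ≤ _ := by gcongr
    exact_mod_cast h2)
  obtain ⟨pos, hpos, hlt, hp1, hp2⟩ := exists_position hσ x
  obtain ⟨hb1, hb2⟩ := block_bounds pos hpos hlt M (by omega) (by omega)
  let J : Fin 5 → Finset V := fun j => (Finset.Icc 1 D).image fun k => (σ ^ k) (a j)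
  have hJ : ∀ j, (D : ℝ) ≤ (J j).card := by
    intro j
    rw [Finset.card_image_of_injOn]
    · simp
    · intro k hk k' hk' h
      simp only [Finset.coe_Icc, Set.mem_Icc] at hk hk'
      have := (hσ.bijective_pow (a j)).1 (a₁ := ⟨k, by omega⟩) (a₂ := ⟨k', by omega⟩) h
      exact congrArg Fin.val this
  have hcount := pow_le_card_closed_walk A J (c / 400 * n) (c * n ^ 4) (by positivity) (by positivity)
    (fun j => hD2.trans (hJ j))
    (fun u v => hW σ u v)
  set F := Finset.univ.filter fun f : Fin 5 × Fin 5 → V =>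
      (∀ j, f (j, 0) ∈ J j) ∧ ∀ i, A (f i) (f (lexSucc i)) with hF
  let Q : (Fin 5 × Fin 5) × Option (Fin 5 × Fin 5) → (Fin 5 × Fin 5 → V) → Finset V := fun k f =>
    match k.2 with
    | none => E ∪ Finset.univ.biUnion fun j => Finset.univ.filter fun v => pos v / M = pos (a j) / M
    | some m => if m = k.1 then ∅ else Finset.univ.filter fun v => pos v / M = pos (f m) / M
  have key := card_mul_le_card_filter_avoid F (fun k => k.1) Q (E.card + 5 * M) (by
      rintro ⟨l, _ | m⟩ f v
      · rfl
      · by_cases hm : m = l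
        · simp [Q, hm]
        · simp [Q, hm]) (by
      rintro ⟨l, _ | m⟩ f
      · refine (Finset.card_union_le _ _).trans (Nat.add_le_add_left ?_ _)
        refine Finset.card_biUnion_le.trans ?_
        refine (Finset.sum_le_sum fun j _ => hb1 _).trans ?_
        simp
      · by_cases hm : m = l
        · simp [Q, hm]
        · simp only [Q, hm, if_false]
          have := hb1 (pos (f m) / M)
          omega)
  set F' := F.filter fun f => ∀ k : (Fin 5 × Fin 5) × Option (Fin 5 × Fin 5), f k.1 ∉ Q k f with hF'
  simp only [Fintype.card_prod, Fintype.card_fin, Fintype.card_option] at key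
  rw [show 5 * 5 = 25 from rfl, show 25 * (25 + 1) = 650 from rfl] at key
  have hF'card : δ₀ / 2 * (n : ℝ) ^ Fintype.card (Fin 5 × Fin 5) ≤ F'.card := by
    rw [Fintype.card_prod, Fintype.card_fin]
    have key' : F.card * n ≤ F'.card * n + 650 * (E.card + 5 * M) * n ^ 25 := by
      convert key
    have e : δ₀ * (n : ℝ) ^ 25 = (c / 400 * n) ^ 5 * (c * n ^ 4) ^ 5 := by rw [hδ₀]; ring
    have k2 : δ₀ * (n : ℝ) ^ 25 ≤ F.card := by
      rw [e]
      convert hcount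
    exact half_density_le_of_avoid hn0 key' k2 (by linarith)
  clear key
  obtain ⟨e, he1, he2⟩ := hM₀ M (by omega) V (fun v => pos v / M) pos hpos (by omega) hb1 hb2 F'
    hF'card
  have hmem : ∀ ε : Fin 5 × Fin 5 → Bool, ((∀ j, e (j, 0) (ε (j, 0)) ∈ J j) ∧
      ∀ i, A (e i (ε i)) (e (lexSucc i) (ε (lexSucc i)))) ∧
      ∀ k : (Fin 5 × Fin 5) × Option (Fin 5 × Fin 5), e k.1 (ε k.1) ∉ Q k (fun i => e i (ε i)) := by
    intro ε
    have := he2 ε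
    simpa only [F', F, Finset.mem_filter, Finset.mem_univ, true_and] using this
  have hpick : ∀ (i j : Fin 5 × Fin 5) (b b' : Bool), i ≠ j →
      ∃ ε : Fin 5 × Fin 5 → Bool, ε i = b ∧ ε j = b' := by
    intro i j b b' hij
    exact ⟨fun k => if k = i then b else b', by simp, by simp [hij.symm]⟩
  have hnone : ∀ i b, e i b ∉ E ∧ ∀ j, pos (e i b) / M ≠ pos (a j) / M := by
    intro i b
    have := (hmem fun _ => b).2 (i, none)
    simpa [Q] using this
  obtain ⟨τ, Z, t1, t2, t3, t4, t5, t6⟩ := exists_isFullCycle_of_doubled hσ A D M hDn x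
    pos hlt hp1 hp2 a haA hsep e he1 (by
      intro i j b b' hij
      obtain ⟨ε, rfl, rfl⟩ := hpick i j b b' hij
      have := (hmem ε).2 (i, some j)
      simpa [Q, hij.symm] using this) (fun i j b => (hnone i b).2 j) (by
      intro i b b'
      obtain ⟨ε, rfl, rfl⟩ := hpick i (lexSucc i) b b' (lexSucc_ne i).symm
      exact (hmem ε).1.2 i) (by
      intro j
      have := (hmem fun _ => false).1.1 j
      obtain ⟨k, hk, hk'⟩ := Finset.mem_image.mp this
      rw [Finset.mem_Icc] at hk
      exact ⟨k, hk.1, hk.2, hk'⟩)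
  have hEm : ∀ z, z ∉ E → z ∉ Dp ∧ σ z ∉ Dm := by
    intro z hz
    simpa [E] using hz
  refine ⟨τ, Z, t1, t2, ha0 ▸ t3, t4, ?_, ?_⟩
  · intro z hz
    obtain ⟨y, hy, hy'⟩ := t5 z hz
    rw [hy]
    exact hy'
  · intro z hz hzx
    apply hEm
    rcases t6 z hz with ⟨j, rfl⟩ | ⟨i, b, rfl⟩
    · exact haE j fun hj => hzx (by rw [hj, ha0])
    · exact (hnone i b).1

end FixMain

section Iteration

variable {V : Type*} [DecidableEq V]

/-- The relation `H` can repair a full cycle at any single vertex, changing at most `55` edges and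
avoiding the given sets elsewhere. -/
def Repairs (H : V → V → Prop) (Dp Dm : Finset V) : Prop :=
  ∀ σ : Equiv.Perm V, IsFullCycle σ → ∀ x, ∃ τ : Equiv.Perm V, ∃ Z : Finset V,
    IsFullCycle τ ∧ Z.card ≤ 55 ∧ x ∈ Z ∧ (∀ z ∉ Z, τ z = σ z) ∧ (∀ z ∈ Z, H z (τ z)) ∧
    ∀ z ∈ Z, z ≠ x → z ∉ Dp ∧ σ z ∉ Dm

/-- `σ` is a repaired version of `σ₀`, changed on `C ⊇ B` with new edges from `H`. -/
structure IsRepair (H : V → V → Prop) (σ₀ : Equiv.Perm V) (B : Finset V) (σ : Equiv.Perm V)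
    (C : Finset V) : Prop where
  full : IsFullCycle σ
  subset : B ⊆ C
  card_le : C.card ≤ 55 * B.card
  agree : ∀ v ∉ C, σ v = σ₀ v
  edge : ∀ v ∈ C, H v (σ v)

lemma Repairs.exists_isRepair {H : V → V → Prop} {Dp Dm : Finset V} (h : Repairs H Dp Dm)
    {σ₀ : Equiv.Perm V} (hσ₀ : IsFullCycle σ₀) (B : Finset V) :
    ∃ σ C, IsRepair H σ₀ B σ C ∧ ∀ v ∈ C, v ∉ B → v ∉ Dp ∧ σ₀ v ∉ Dm := by
  induction B using Finset.induction_on with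
  | empty => exact ⟨σ₀, ∅, ⟨hσ₀, by simp, by simp, by simp, by simp⟩, by simp⟩
  | insert x B hx ih =>
    obtain ⟨σ, C, ⟨h1, h2, h3, h4, h5⟩, h6⟩ := ih
    by_cases hxC : x ∈ C
    · refine ⟨σ, C, ⟨h1, Finset.insert_subset hxC h2, h3.trans ?_, h4, h5⟩, ?_⟩
      · rw [Finset.card_insert_of_notMem hx]; omega
      · exact fun v hv hvB => h6 v hv fun h => hvB (Finset.mem_insert_of_mem h)
    · obtain ⟨τ, Z, t1, t2, t3, t4, t5, t6⟩ := h σ h1 x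
      refine ⟨τ, C ∪ Z, ⟨t1, ?_, ?_, ?_, ?_⟩, ?_⟩
      · refine Finset.insert_subset (Finset.mem_union_right _ t3) ?_
        exact h2.trans Finset.subset_union_left
      · rw [Finset.card_insert_of_notMem hx]
        have := Finset.card_union_le C Z
        omega
      · intro v hv
        rw [Finset.mem_union, not_or] at hv
        rw [t4 v hv.2, h4 v hv.1]
      · intro v hv
        by_cases hvZ : v ∈ Z
        · exact t5 v hvZ
        · rw [t4 v hvZ]
          exact h5 v ((Finset.mem_union.mp hv).resolve_right hvZ)
      · intro v hv hvB
        rw [Finset.mem_insert, not_or] at hvB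
        by_cases hvC : v ∈ C
        · exact h6 v hvC hvB.2
        · rw [← h4 v hvC]
          exact t6 v ((Finset.mem_union.mp hv).resolve_left hvC) hvB.1

lemma IsRepair.symm_mem {H : V → V → Prop} {σ₀ σ : Equiv.Perm V} {B C : Finset V}
    (h : IsRepair H σ₀ B σ C) {b : V} (hb : σ.symm b ∈ C) : σ₀.symm b ∈ C := by
  by_contra hcon
  have := h.agree _ hcon
  rw [Equiv.apply_symm_apply] at this
  rw [← this, Equiv.symm_apply_apply] at hb
  exact hcon hb

lemma card_le_of_heavy [Fintype V] {C : ℕ → Finset V} (π : ℕ → Equiv.Perm V) (m L T : ℕ) (hL : 0 < L)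
    (hT : ∑ j ∈ Finset.range m, (C j).card ≤ T * L) :
    (Finset.univ.filter fun v =>
      L ≤ ((Finset.range m).filter fun j => π j v ∈ C j).card).card ≤ T := by
  set D := Finset.univ.filter fun v => L ≤ ((Finset.range m).filter fun j => π j v ∈ C j).card
  have h1 : D.card * L ≤ ∑ v ∈ D, ((Finset.range m).filter fun j => π j v ∈ C j).card := by
    rw [← smul_eq_mul]
    exact Finset.card_nsmul_le_sum _ _ _ fun v hv => (Finset.mem_filter.mp hv).2
  have h2 : ∑ v ∈ D, ((Finset.range m).filter fun j => π j v ∈ C j).card ≤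
      ∑ v, ((Finset.range m).filter fun j => π j v ∈ C j).card :=
    Finset.sum_le_sum_of_subset (Finset.subset_univ _)
  have h3 : ∑ v, ((Finset.range m).filter fun j => π j v ∈ C j).card =
      ∑ j ∈ Finset.range m, (C j).card := by
    simp only [Finset.card_filter]
    rw [Finset.sum_comm]
    refine Finset.sum_congr rfl fun j _ => ?_
    rw [← Finset.card_filter]
    refine Finset.card_bij (fun v _ => π j v) (fun v hv => by simpa using hv)
      (fun _ _ _ _ h => (π j).injective h) fun w hw => ⟨(π j).symm w, by simpa using hw, by simp⟩
  exact Nat.le_of_mul_le_mul_right (h1.trans (h2.trans (h3.le.trans hT))) hL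

/-- Repairing a sequence of full cycles with pairwise disjoint sets of edges from `H`. -/
lemma exists_repairs [Fintype V] (H : V → V → Prop) (R L X T : ℕ) (hL : 0 < L) (σ₀ : ℕ → Equiv.Perm V)
    (B : ℕ → Finset V) (hσ₀ : ∀ j < R, IsFullCycle (σ₀ j))
    (hfix : ∀ H' : V → V → Prop, (∀ a b, H' a b → H a b) →
      (∀ a, (Finset.univ.filter fun b => H a b ∧ ¬ H' a b).card ≤ X) →
      (∀ b, (Finset.univ.filter fun a => H a b ∧ ¬ H' a b).card ≤ X) →
      ∀ Dp Dm : Finset V, Dp.card ≤ T → Dm.card ≤ T → Repairs H' Dp Dm)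
    (hout : ∀ v, ((Finset.range R).filter fun j => v ∈ B j).card + L ≤ X)
    (hin : ∀ w, ((Finset.range R).filter fun j => (σ₀ j).symm w ∈ B j).card + L ≤ X)
    (hT : 55 * ∑ j ∈ Finset.range R, (B j).card ≤ T * L) :
    ∃ σ : ℕ → Equiv.Perm V, ∃ C : ℕ → Finset V, (∀ j < R, IsRepair H (σ₀ j) (B j) (σ j) (C j)) ∧
      ∀ i j, i < j → j < R → ∀ v ∈ C i, v ∈ C j → σ i v ≠ σ j v := by
  suffices hmain : ∀ m ≤ R, ∃ σ : ℕ → Equiv.Perm V, ∃ C : ℕ → Finset V,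
      (∀ j < m, IsRepair H (σ₀ j) (B j) (σ j) (C j)) ∧
      (∀ i j, i < j → j < m → ∀ v ∈ C i, v ∈ C j → σ i v ≠ σ j v) ∧
      (∀ v, ((Finset.range m).filter fun j => v ∈ C j \ B j).card ≤ L) ∧
      (∀ w, ((Finset.range m).filter fun j => (σ₀ j).symm w ∈ C j \ B j).card ≤ L) by
    obtain ⟨σ, C, h1, h2, -⟩ := hmain R le_rfl
    exact ⟨σ, C, h1, h2⟩
  intro m
  induction m with
  | zero => exact fun _ => ⟨σ₀, B, by simp⟩
  | succ m ih =>
    intro hm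
    obtain ⟨σ, C, h1, h2, h3, h4⟩ := ih (by omega)
    have hsub : Finset.range m ⊆ Finset.range R := Finset.range_subset_range.mpr (by omega)
    obtain ⟨H', hH'⟩ : ∃ H' : V → V → Prop, ∀ a b, H' a b ↔
        H a b ∧ ∀ j < m, ¬ (a ∈ C j ∧ σ j a = b) := ⟨_, fun _ _ => Iff.rfl⟩
    let Dp := Finset.univ.filter fun v =>
      L ≤ ((Finset.range m).filter fun j => v ∈ C j \ B j).card
    let Dm := Finset.univ.filter fun w =>
      L ≤ ((Finset.range m).filter fun j => (σ₀ j).symm w ∈ C j \ B j).card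
    have hTm : ∑ j ∈ Finset.range m, (C j \ B j).card ≤ T * L := by
      refine le_trans ?_ hT
      rw [Finset.mul_sum]
      refine (Finset.sum_le_sum fun j hj => ?_).trans (Finset.sum_le_sum_of_subset hsub)
      exact (Finset.card_le_card Finset.sdiff_subset).trans (h1 j (Finset.mem_range.mp hj)).card_le
    have hDp : Dp.card ≤ T := card_le_of_heavy (fun _ => Equiv.refl V) m L T hL hTm
    have hDm : Dm.card ≤ T := card_le_of_heavy (fun j => (σ₀ j).symm) m L T hL hTm
    have hsplit : ∀ u : ℕ → V, ((Finset.range m).filter fun j => u j ∈ C j).card ≤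
        ((Finset.range R).filter fun j => u j ∈ B j).card +
        ((Finset.range m).filter fun j => u j ∈ C j \ B j).card := by
      intro u
      refine le_trans (Finset.card_le_card ?_) (Finset.card_union_le _ _)
      intro j hj
      simp only [Finset.mem_filter, Finset.mem_union, Finset.mem_sdiff] at hj ⊢
      by_cases hjB : u j ∈ B j
      · exact .inl ⟨hsub hj.1, hjB⟩
      · exact .inr ⟨hj.1, hj.2, hjB⟩
    have hrep : Repairs H' Dp Dm := by
      refine hfix H' (fun a b h => ((hH' a b).mp h).1) ?_ ?_ Dp Dm hDp hDm
      · intro a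
        have : (Finset.univ.filter fun b => H a b ∧ ¬ H' a b) ⊆
            ((Finset.range m).filter fun j => a ∈ C j).image fun j => σ j a := by
          intro b hb
          simp only [Finset.mem_filter, Finset.mem_univ, true_and, hH', not_and, not_forall,
            not_not, exists_prop] at hb
          obtain ⟨hb1, hb2⟩ := hb
          obtain ⟨j, hj, hj1, hj2⟩ := hb2 hb1
          exact Finset.mem_image.mpr ⟨j, by simp [hj, hj1], hj2⟩
        refine (Finset.card_le_card this).trans (Finset.card_image_le.trans ?_)
        exact (hsplit fun _ => a).trans ((Nat.add_le_add_left (h3 a) _).trans (hout a))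
      · intro b
        have : (Finset.univ.filter fun a => H a b ∧ ¬ H' a b) ⊆
            ((Finset.range m).filter fun j => (σ₀ j).symm b ∈ C j).image
              fun j => (σ j).symm b := by
          intro a ha
          simp only [Finset.mem_filter, Finset.mem_univ, true_and, hH', not_and, not_forall,
            not_not, exists_prop] at ha
          obtain ⟨ha1, ha2⟩ := ha
          obtain ⟨j, hj, hj1, hj2⟩ := ha2 ha1
          refine Finset.mem_image.mpr ⟨j, ?_, by rw [← hj2]; simp⟩
          rw [Finset.mem_filter]
          refine ⟨Finset.mem_range.mpr hj, (h1 j hj).symm_mem ?_⟩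
          rw [← hj2]; simpa using hj1
        refine (Finset.card_le_card this).trans (Finset.card_image_le.trans ?_)
        exact (hsplit fun j => (σ₀ j).symm b).trans ((Nat.add_le_add_left (h4 b) _).trans (hin b))
    obtain ⟨τ, Z, hτ, hZ⟩ := hrep.exists_isRepair (hσ₀ m (by omega)) (B m)
    have hcap : ∀ (u : ℕ → V), ((Finset.range m).filter fun j => u j ∈ C j \ B j).card ≤ L →
        (u m ∈ Z \ B m → ¬ L ≤ ((Finset.range m).filter fun j => u j ∈ C j \ B j).card) →
        ((Finset.range (m + 1)).filter fun j => u j ∈ Function.update C m Z j \ B j).card ≤ L := by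
      intro u hu1 hu2
      have e : ((Finset.range m).filter fun j => u j ∈ Function.update C m Z j \ B j) =
          ((Finset.range m).filter fun j => u j ∈ C j \ B j) := by
        refine Finset.filter_congr fun j hj => ?_
        rw [Function.update_of_ne (Finset.mem_range.mp hj).ne]
      rw [Finset.range_add_one, Finset.filter_insert, e, Function.update_self]
      split_ifs with h
      · refine (Finset.card_insert_le _ _).trans ?_
        have := hu2 h
        omega
      · exact hu1
    refine ⟨Function.update σ m τ, Function.update C m Z, ?_, ?_, ?_, ?_⟩
    · intro j hj
      rcases Nat.lt_succ_iff_lt_or_eq.mp hj with h | rfl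
      · rw [Function.update_of_ne h.ne, Function.update_of_ne h.ne]
        exact h1 j h
      · rw [Function.update_self, Function.update_self]
        exact ⟨hτ.full, hτ.subset, hτ.card_le, hτ.agree, fun v hv => ((hH' _ _).mp (hτ.edge v hv)).1⟩
    · intro i j hij hj v
      rcases Nat.lt_succ_iff_lt_or_eq.mp hj with h | rfl
      · rw [Function.update_of_ne h.ne, Function.update_of_ne h.ne,
          Function.update_of_ne (hij.trans h).ne, Function.update_of_ne (hij.trans h).ne]
        exact h2 i j hij h v
      · rw [Function.update_self, Function.update_self, Function.update_of_ne hij.ne,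
          Function.update_of_ne hij.ne]
        exact fun hi hj heq => ((hH' _ _).mp (hτ.edge v hj)).2 i hij ⟨hi, heq⟩
    · intro v
      refine hcap (fun _ => v) (h3 v) fun hv => ?_
      rw [Finset.mem_sdiff] at hv
      simpa [Dp] using (hZ v hv.1 hv.2).1
    · intro w
      refine hcap (fun j => (σ₀ j).symm w) (h4 w) fun hv => ?_
      rw [Finset.mem_sdiff] at hv
      simpa [Dm] using (hZ _ hv.1 hv.2).2

end Iteration

section Density

/-- The number of edges of a relation from `S` to `T`. -/
noncomputable def edgeCount {V : Type*} (G : V → V → Prop) (S T : Finset V) : ℕ :=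
  ((S ×ˢ T).filter fun p => G p.1 p.2).card

lemma edgeCount_eq_sum {V : Type*} (G : V → V → Prop) (S T : Finset V) :
    edgeCount G S T = ∑ a ∈ S, (T.filter fun b => G a b).card := by
  rw [edgeCount, Finset.card_filter, Finset.sum_product]
  simp only [Finset.card_filter]

lemma edgeCount_flip {V : Type*} (G : V → V → Prop) (S T : Finset V) :
    edgeCount (fun a b => G b a) T S = edgeCount G S T := by
  simp only [edgeCount_eq_sum, Finset.card_filter]
  exact Finset.sum_comm

lemma edgeCount_le_mul {V : Type*} (G : V → V → Prop) (S T : Finset V) :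
    edgeCount G S T ≤ S.card * T.card := by
  rw [← Finset.card_product]
  exact Finset.card_filter_le _ _

lemma edgeCount_mono {V : Type*} (G : V → V → Prop) {S S' T T' : Finset V} (hS : S ⊆ S')
    (hT : T ⊆ T') : edgeCount G S T ≤ edgeCount G S' T' :=
  Finset.card_le_card (Finset.filter_subset_filter _ (Finset.product_subset_product hS hT))

lemma edgeCount_union_right {V : Type*} (G : V → V → Prop) (S : Finset V) {T T' : Finset V}
    (h : Disjoint T T') : edgeCount G S (T ∪ T') = edgeCount G S T + edgeCount G S T' := by
  simp only [edgeCount_eq_sum, ← Finset.sum_add_distrib]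
  refine Finset.sum_congr rfl fun a _ => ?_
  rw [Finset.filter_union, Finset.card_union_of_disjoint (Finset.disjoint_filter_filter h)]

lemma edgeCount_union_left {V : Type*} (G : V → V → Prop) {S S' : Finset V} (T : Finset V)
    (h : Disjoint S S') : edgeCount G (S ∪ S') T = edgeCount G S T + edgeCount G S' T := by
  simp only [edgeCount_eq_sum]
  exact Finset.sum_union h

lemma two_mul_edgeCount_self_le {V : Type*} (G : V → V → Prop) (hG : ∀ u v, G u v → ¬ G v u)
    (Z : Finset V) : 2 * edgeCount G Z Z ≤ Z.card * Z.card := by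
  have h1 : edgeCount G Z Z + edgeCount (fun a b => G b a) Z Z ≤ (Z ×ˢ Z).card := by
    rw [edgeCount, edgeCount, ← Finset.card_union_of_disjoint]
    · exact Finset.card_le_card (Finset.union_subset (Finset.filter_subset _ _)
        (Finset.filter_subset _ _))
    · rw [Finset.disjoint_filter]
      exact fun p _ hp => hG _ _ hp
  have h2 := edgeCount_flip G Z Z
  rw [h2, Finset.card_product] at h1
  omega

lemma card_filter_add_le {V : Type*} [Fintype V] (P : V → Prop) (T : Finset V) :
    (Finset.univ.filter P).card + T.card ≤ (T.filter P).card + Fintype.card V := by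
  have h1 := Finset.card_union_add_card_inter (Finset.univ.filter P) T
  have h2 : Finset.univ.filter P ∩ T = T.filter P := by
    ext; simp [and_comm]
  rw [h2] at h1
  have := Finset.card_le_univ (Finset.univ.filter P ∪ T)
  omega

lemma le_edgeCount_self {V : Type*} [Fintype V] (G : V → V → Prop) (hG : ∀ u v, G u v → ¬ G v u)
    (r : ℝ) (hr : ∀ v, r ≤ outDeg G v ∧ r ≤ inDeg G v) (Y : Finset V) :
    (Y.card : ℝ) * (Y.card + 2 * r - Fintype.card V) ≤ 2 * edgeCount G Y Y := by
  have h1 : ∀ v, (Y.card : ℝ) + 2 * r - Fintype.card V ≤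
      (Y.filter fun b => G v b).card + (Y.filter fun b => G b v).card := by
    intro v
    obtain ⟨P, hP⟩ : ∃ P : V → Prop, ∀ b, P b ↔ (G v b ∨ G b v) := ⟨_, fun _ => Iff.rfl⟩
    have h2 := card_filter_add_le P Y
    have h3 : Disjoint (Finset.univ.filter fun b => G v b) (Finset.univ.filter fun b => G b v) := by
      rw [Finset.disjoint_filter]
      exact fun b _ hb => hG _ _ hb
    have h8 : ∀ s : Finset V, s.filter P =
        (s.filter fun b => G v b) ∪ s.filter fun b => G b v := by
      intro s; ext b; simp [hP, and_or_left]
    rw [h8, h8, Finset.card_union_of_disjoint h3] at h2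
    have h4 := Finset.card_union_le (Y.filter fun b => G v b) (Y.filter fun b => G b v)
    obtain ⟨h5, h6⟩ := hr v
    unfold outDeg at h5
    unfold inDeg at h6
    have h7 : ((Finset.univ.filter fun b => G v b).card : ℝ) +
      (Finset.univ.filter fun b => G b v).card + Y.card ≤ (Y.filter fun b => G v b).card +
      (Y.filter fun b => G b v).card + Fintype.card V := by
      exact_mod_cast h2.trans (Nat.add_le_add_right h4 _)
    linarith
  have h2 := edgeCount_eq_sum G Y Y
  have h3 := edgeCount_eq_sum (fun a b => G b a) Y Y
  rw [edgeCount_flip G Y Y] at h3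
  have h4 : (2 * edgeCount G Y Y : ℝ) = ∑ v ∈ Y, (((Y.filter fun b => G v b).card : ℝ) +
      (Y.filter fun b => G b v).card) := by
    rw [Finset.sum_add_distrib, two_mul]
    congr 1
    · rw [h2]; push_cast; rfl
    · rw [h3]; push_cast; rfl
  rw [h4, ← nsmul_eq_mul]
  exact Finset.card_nsmul_le_sum _ _ _ fun v _ => h1 v

/-- In a nearly regular oriented graph of density close to one, any two sets of about half of the
vertices span many edges. -/
lemma sq_le_edgeCount {V : Type*} [Fintype V] (G : V → V → Prop) (hG : ∀ u v, G u v → ¬ G v u)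
    (hdeg : ∀ v, 499 / 1000 * (Fintype.card V : ℝ) ≤ outDeg G v ∧
      499 / 1000 * (Fintype.card V : ℝ) ≤ inDeg G v)
    (S T : Finset V) (hS : 495 / 1000 * (Fintype.card V : ℝ) ≤ S.card)
    (hT : 495 / 1000 * (Fintype.card V : ℝ) ≤ T.card) :
    1 / 2000 * (Fintype.card V : ℝ) ^ 2 ≤ edgeCount G S T := by
  by_contra! hcon
  set n : ℝ := ((Fintype.card V : ℕ) : ℝ) with hn
  have hn0 : 0 ≤ n := by positivity
  have hT2 : (T.card : ℝ) + Tᶜ.card = n := by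
    rw [hn]
    exact_mod_cast Finset.card_add_card_compl T
  have hsplit : (S ∩ T) ∪ (S ∩ Tᶜ) = S := by
    ext v; by_cases h : v ∈ T <;> simp [h]
  have hdis : Disjoint (S ∩ T) (S ∩ Tᶜ) := by
    rw [Finset.disjoint_left]; intro v; simp only [Finset.mem_inter, Finset.mem_compl]; tauto
  have hs : ((S ∩ T).card : ℝ) + (S ∩ Tᶜ).card = S.card := by
    have := Finset.card_union_of_disjoint hdis
    rw [hsplit] at this
    rw [this]; push_cast; rfl
  have hU : (S ∩ Tᶜ) ∪ (Tᶜ \ S) = Tᶜ := by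
    ext v; by_cases h : v ∈ S <;> simp [h]
  have hUd : Disjoint (S ∩ Tᶜ) (Tᶜ \ S) := by
    rw [Finset.disjoint_left]; intro v; simp only [Finset.mem_inter, Finset.mem_sdiff]; tauto
  have hUc : ((S ∩ Tᶜ).card : ℝ) + (Tᶜ \ S).card = Tᶜ.card := by
    have := Finset.card_union_of_disjoint hUd
    rw [hU] at this
    rw [this]; push_cast; rfl
  have e1 : edgeCount G (S ∩ T) (S ∩ T) ≤ edgeCount G S T :=
    edgeCount_mono G Finset.inter_subset_left Finset.inter_subset_right
  have e1' : (edgeCount G (S ∩ T) (S ∩ T) : ℝ) ≤ edgeCount G S T := by exact_mod_cast e1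
  have e2 := le_edgeCount_self G hG (499 / 1000 * n) hdeg (S ∩ T)
  have e3 : (S.card : ℝ) * (499 / 1000 * n) ≤ edgeCount G S Finset.univ := by
    rw [edgeCount_eq_sum]
    push_cast
    rw [← nsmul_eq_mul]
    exact Finset.card_nsmul_le_sum _ _ _ fun v _ => (hdeg v).1
  have e4 : edgeCount G S Finset.univ = edgeCount G S T + (edgeCount G (S ∩ T) Tᶜ +
      (edgeCount G (S ∩ Tᶜ) (S ∩ Tᶜ) + edgeCount G (S ∩ Tᶜ) (Tᶜ \ S))) := by
    rw [← edgeCount_union_right _ _ hUd, hU, ← edgeCount_union_left _ _ hdis, hsplit,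
      ← edgeCount_union_right _ _ disjoint_compl_right, Finset.union_compl]
  have e4' : (edgeCount G S Finset.univ : ℝ) = edgeCount G S T + (edgeCount G (S ∩ T) Tᶜ +
      (edgeCount G (S ∩ Tᶜ) (S ∩ Tᶜ) + edgeCount G (S ∩ Tᶜ) (Tᶜ \ S))) := by exact_mod_cast e4
  have e5 : (edgeCount G (S ∩ T) Tᶜ : ℝ) ≤ (S ∩ T).card * Tᶜ.card := by
    exact_mod_cast edgeCount_le_mul _ _ _
  have e6 : (edgeCount G (S ∩ Tᶜ) (Tᶜ \ S) : ℝ) ≤ (S ∩ Tᶜ).card * (Tᶜ \ S).card := by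
    exact_mod_cast edgeCount_le_mul _ _ _
  have e7 : (2 * edgeCount G (S ∩ Tᶜ) (S ∩ Tᶜ) : ℝ) ≤ (S ∩ Tᶜ).card * (S ∩ Tᶜ).card := by
    exact_mod_cast two_mul_edgeCount_self_le G hG _
  rw [e4'] at e3
  rw [← hn] at e2
  have hSn : (S.card : ℝ) ≤ n := by rw [hn]; exact_mod_cast Finset.card_le_univ S
  have ha0 : (0 : ℝ) ≤ edgeCount G S T := by positivity
  generalize ((S ∩ T).card : ℝ) = y at *
  have hz0 : (0 : ℝ) ≤ (S ∩ Tᶜ).card := by positivity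
  generalize ((S ∩ Tᶜ).card : ℝ) = z at *
  generalize (S.card : ℝ) = s at *
  generalize (Tᶜ.card : ℝ) = u at *
  generalize (T.card : ℝ) = t at *
  generalize ((Tᶜ \ S).card : ℝ) = q at *
  generalize (edgeCount G S T : ℝ) = a at *
  generalize (edgeCount G (S ∩ T) (S ∩ T) : ℝ) = b at *
  generalize (edgeCount G (S ∩ T) Tᶜ : ℝ) = b1 at *
  generalize (edgeCount G (S ∩ Tᶜ) (S ∩ Tᶜ) : ℝ) = b2 at *
  generalize (edgeCount G (S ∩ Tᶜ) (Tᶜ \ S) : ℝ) = b3 at *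
  have hnpos : 0 < n := by
    rcases hn0.lt_or_eq with h | h
    · exact h
    · rw [← h] at hcon
      norm_num at hcon
      linarith
  have hy : y ≤ 34 / 1000 * n := by
    by_contra! h
    nlinarith
  obtain rfl : s = y + z := hs.symm
  obtain rfl : q = u - z := by linarith
  have hu : u ≤ 505 / 1000 * n := by linarith
  have h9 : (y + z) * (499 / 1000 * n) + z * z / 2 ≤ 1 / 2000 * n ^ 2 + (y + z) * u := by
    nlinarith
  have h10 : (y + z) * u ≤ (y + z) * (505 / 1000 * n) :=
    mul_le_mul_of_nonneg_left hu (by linarith)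
  have hz : 461 / 1000 * n ≤ z := by linarith
  have h11 : (461 / 1000 * n) * (461 / 1000 * n) ≤ z * z :=
    mul_self_le_mul_self (by positivity) hz
  nlinarith

end Density

section Walks

lemma card_mul_sub_le_of_heavy {V : Type*} [Fintype V] (A G : V → V → Prop) (K r w g : ℝ)
    (hK : 0 < K) (hr : ∀ v, r ≤ outDeg G v)
    (hAG : ∀ S T, edgeCount G S T / K - w ≤ (edgeCount A S T : ℝ)) (hg : 0 ≤ g) (S : Finset V) :
    (S.card : ℝ) * (r - (Finset.univ.filter fun b => g ≤ (S.filter fun a => A a b).card).card) ≤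
      K * (g * Fintype.card V + w) := by
  set N := Finset.univ.filter fun b => g ≤ (S.filter fun a => A a b).card with hN
  have h1 : (edgeCount A S Nᶜ : ℝ) ≤ g * Fintype.card V := by
    rw [← edgeCount_flip, edgeCount_eq_sum]
    push_cast
    have : ∀ b ∈ Nᶜ, ((S.filter fun a => A a b).card : ℝ) ≤ g := by
      intro b hb
      rw [Finset.mem_compl, hN, Finset.mem_filter, not_and, not_le] at hb
      exact (hb (Finset.mem_univ _)).le
    refine (Finset.sum_le_card_nsmul _ _ _ this).trans ?_
    rw [nsmul_eq_mul, mul_comm]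
    refine mul_le_mul_of_nonneg_left ?_ hg
    exact_mod_cast Finset.card_le_univ _
  have h2 : (S.card : ℝ) * (r - N.card) ≤ edgeCount G S Nᶜ := by
    rw [edgeCount_eq_sum]
    push_cast
    rw [← nsmul_eq_mul]
    refine Finset.card_nsmul_le_sum _ _ _ fun a _ => ?_
    have h3 := card_filter_add_le (fun b => G a b) Nᶜ
    have h4 := Finset.card_add_card_compl N
    have h5 := hr a
    unfold outDeg at h5
    have h6 : ((Finset.univ.filter fun b => G a b).card : ℝ) ≤
        (Nᶜ.filter fun b => G a b).card + N.card := by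
      exact_mod_cast (by omega : (Finset.univ.filter fun b => G a b).card ≤
        (Nᶜ.filter fun b => G a b).card + N.card)
    linarith
  have h3 := hAG S Nᶜ
  have h4 : (edgeCount G S Nᶜ : ℝ) / K ≤ g * Fintype.card V + w := by linarith
  rw [div_le_iff₀ hK] at h4
  linarith

lemma mul_sq_le_card_walks {V : Type*} [Fintype V] (A : V → V → Prop) (x y : V)
    (S T : Finset V) (g : ℝ) (hg : 0 ≤ g)
    (hS : ∀ b ∈ S, g ≤ ((Finset.univ.filter fun a => A x a ∧ A a b).card : ℝ))
    (hT : ∀ b ∈ T, g ≤ ((Finset.univ.filter fun a => A b a ∧ A a y).card : ℝ)) :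
    edgeCount A S T * (g * g) ≤
      ((Finset.univ.filter fun w : Fin 4 → V => IsWalkFive A x w y).card : ℝ) := by
  let E := ((S ×ˢ T).filter fun p => A p.1 p.2).sigma fun p =>
    (Finset.univ.filter fun a => A x a ∧ A a p.1) ×ˢ (Finset.univ.filter fun a => A p.2 a ∧ A a y)
  have h1 : edgeCount A S T * (g * g) ≤ (E.card : ℝ) := by
    rw [Finset.card_sigma]
    push_cast
    rw [edgeCount, ← nsmul_eq_mul]
    refine Finset.card_nsmul_le_sum _ _ _ fun p hp => ?_
    rw [Finset.mem_filter, Finset.mem_product] at hp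
    rw [Finset.card_product]
    push_cast
    exact mul_le_mul (hS _ hp.1.1) (hT _ hp.1.2) hg (by positivity)
  refine h1.trans ?_
  norm_cast
  refine Finset.card_le_card_of_injOn (fun q => ![q.2.1, q.1.1, q.1.2, q.2.2]) ?_ ?_
  · rintro ⟨⟨b, c⟩, a, d⟩ h
    simp only [E, Finset.mem_coe, Finset.mem_sigma, Finset.mem_filter, Finset.mem_product,
      Finset.mem_univ, true_and] at h ⊢
    exact ⟨h.2.1.1, h.2.1.2, h.1.2, h.2.2.1, h.2.2.2⟩
  · rintro ⟨⟨b, c⟩, a, d⟩ _ ⟨⟨b', c'⟩, a', d'⟩ _ h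
    have h0 : a = a' := congrFun h 0
    have h1 : b = b' := congrFun h 1
    have h2 : c = c' := congrFun h 2
    have h3 : d = d' := congrFun h 3
    rw [h0, h1, h2, h3]

/-- A relation that inherits a positive proportion of the edges of a nearly regular oriented graph
between any two vertex sets supports many walks with five edges between any two vertices, even
after relabelling the heads of its edges. -/
lemma card_walks_ge {V : Type*} [Fintype V] (G H : V → V → Prop) (hG : ∀ u v, G u v → ¬ G v u)
    (K : ℝ) (hK : 1 ≤ K)
    (hdeg : ∀ v, 499 / 1000 * (Fintype.card V : ℝ) ≤ outDeg G v ∧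
      499 / 1000 * (Fintype.card V : ℝ) ≤ inDeg G v)
    (hH : ∀ v, 1 / (4 * K) * (Fintype.card V : ℝ) ≤ outDeg H v ∧
      1 / (4 * K) * (Fintype.card V : ℝ) ≤ inDeg H v)
    (hHG : ∀ S T, edgeCount G S T / K - 1 / (4000 * K ^ 2) * (Fintype.card V : ℝ) ^ 2 ≤
      (edgeCount H S T : ℝ)) (σ : Equiv.Perm V) (x y : V) :
    1 / (4000 * K) * (1 / (4000 * K ^ 2)) ^ 2 * (Fintype.card V : ℝ) ^ 4 ≤
      ((Finset.univ.filter fun w : Fin 4 → V =>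
        IsWalkFive (fun a b => H a (σ b)) x w y).card : ℝ) := by
  set n : ℝ := ((Fintype.card V : ℕ) : ℝ) with hn
  set γ : ℝ := 1 / (4000 * K ^ 2) with hγ
  have hK0 : 0 < K := by linarith
  have hγ0 : 0 < γ := by positivity
  have hn0 : 0 < n := by
    rw [hn]; exact_mod_cast Fintype.card_pos_iff.mpr ⟨x⟩
  have hmap : ∀ (R : V → V → Prop) (S T : Finset V),
      edgeCount (fun a b => R a (σ b)) S T = edgeCount R S (T.map σ.toEmbedding) := by
    intro R S T
    rw [edgeCount_eq_sum, edgeCount_eq_sum]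
    refine Finset.sum_congr rfl fun a _ => ?_
    rw [Finset.filter_map, Finset.card_map]
    rfl
  have hout : ∀ (R : V → V → Prop) (v : V), outDeg (fun a b => R a (σ b)) v = outDeg R v := by
    intro R v
    unfold outDeg
    refine Finset.card_bij (fun u _ => σ u) (fun u hu => by simpa using hu)
      (fun _ _ _ _ h => σ.injective h) fun w hw => ⟨σ.symm w, by simpa using hw, by simp⟩
  have hcmp : ∀ S T, edgeCount (fun a b => G a (σ b)) S T / K - γ * n ^ 2 ≤
      (edgeCount (fun a b => H a (σ b)) S T : ℝ) := by
    intro S T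
    rw [hmap, hmap]
    exact hHG _ _
  have hcmp' : ∀ S T, edgeCount (fun b a => G a (σ b)) S T / K - γ * n ^ 2 ≤
      (edgeCount (fun b a => H a (σ b)) S T : ℝ) := by
    intro S T
    rw [edgeCount_flip (fun a b => G a (σ b)), edgeCount_flip (fun a b => H a (σ b))]
    exact hcmp _ _
  have hbig : ∀ s t : ℝ, 1 / (4 * K) * n ≤ s → s * (499 / 1000 * n - t) ≤
      K * (γ * n * n + γ * n ^ 2) → 495 / 1000 * n ≤ t := by
    intro s t hs h
    by_contra! hcon
    have h1 : 1 / (4 * K) * n * (499 / 1000 * n - t) ≤ s * (499 / 1000 * n - t) :=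
      mul_le_mul_of_nonneg_right hs (by linarith)
    have h2 : 1 / (4 * K) * n * (4 / 1000 * n) < 1 / (4 * K) * n * (499 / 1000 * n - t) :=
      mul_lt_mul_of_pos_left (by linarith) (by positivity)
    have h3 : K * (γ * n * n + γ * n ^ 2) = 1 / (4 * K) * n * (2 / 1000 * n) := by
      rw [hγ]; field_simp; ring
    have h4 : 1 / (4 * K) * n * (2 / 1000 * n) < 1 / (4 * K) * n * (4 / 1000 * n) :=
      mul_lt_mul_of_pos_left (by linarith) (by positivity)
    linarith
  set A : V → V → Prop := fun a b => H a (σ b) with hA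
  set S := Finset.univ.filter fun b =>
    γ * n ≤ ((Finset.univ.filter fun a => A x a).filter fun a => A a b).card with hS
  set T := Finset.univ.filter fun b =>
    γ * n ≤ ((Finset.univ.filter fun a => A a y).filter fun a => A b a).card with hT
  have hSc : 495 / 1000 * n ≤ S.card := by
    refine hbig (Finset.univ.filter fun a => A x a).card _ ?_
      (card_mul_sub_le_of_heavy A (fun a b => G a (σ b)) K (499 / 1000 * n) (γ * n ^ 2) (γ * n) hK0
        (fun v => ?_) hcmp (by positivity) _)
    · have := (hH x).1
      rw [← hout] at this
      exact this
    · rw [hout]; exact (hdeg v).1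
  have hTc : 495 / 1000 * n ≤ T.card := by
    refine hbig (Finset.univ.filter fun a => A a y).card _ ?_
      (card_mul_sub_le_of_heavy (fun b a => A a b) (fun b a => G a (σ b)) K (499 / 1000 * n)
        (γ * n ^ 2) (γ * n) hK0 (fun v => ?_) hcmp' (by positivity) _)
    · exact (hH (σ y)).2
    · exact (hdeg (σ v)).2
  have h1 := mul_sq_le_card_walks A x y S T (γ * n) (by positivity)
    (fun b hb => by
      have := (Finset.mem_filter.mp hb).2
      rwa [Finset.filter_filter] at this)
    (fun b hb => by
      have := (Finset.mem_filter.mp hb).2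
      rw [Finset.filter_filter] at this
      simpa only [and_comm] using this)
  refine le_trans ?_ h1
  have h2 : 1 / 2000 * n ^ 2 ≤ edgeCount G S (T.map σ.toEmbedding) :=
    sq_le_edgeCount G hG hdeg _ _ hSc (by rwa [Finset.card_map])
  have h3 := hcmp S T
  rw [hmap] at h3
  have h4 : 1 / (4000 * K) * n ^ 2 ≤ edgeCount A S T := by
    refine le_trans ?_ h3
    have h5 : 1 / 2000 * n ^ 2 / K ≤ edgeCount G S (T.map σ.toEmbedding) / K := by gcongr
    have h6 : γ ≤ 1 / (4000 * K) := by
      rw [hγ]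
      apply one_div_le_one_div_of_le (by positivity)
      nlinarith
    have h7 : γ * n ^ 2 ≤ 1 / (4000 * K) * n ^ 2 := by gcongr
    have h8 : 1 / 2000 * n ^ 2 / K = 1 / (4000 * K) * n ^ 2 + 1 / (4000 * K) * n ^ 2 := by
      field_simp; ring
    linarith
  calc 1 / (4000 * K) * γ ^ 2 * n ^ 4 = 1 / (4000 * K) * n ^ 2 * (γ * n * (γ * n)) := by ring
    _ ≤ _ := by gcongr

end Walks

section Coloring

lemma exp_le_add_exp_sq (x : ℝ) : Real.exp x ≤ x + Real.exp (x ^ 2) := by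
  have h1 := Real.add_one_le_exp (x ^ 2)
  rcases le_or_gt |x| 1 with h | h
  · have := (abs_le.mp (Real.abs_exp_sub_one_sub_id_le h)).2
    linarith
  · rcases le_or_gt 0 x with h0 | h0
    · rw [abs_of_nonneg h0] at h
      have : Real.exp x ≤ Real.exp (x ^ 2) := Real.exp_le_exp.mpr (by nlinarith)
      linarith
    · rw [abs_of_neg h0] at h
      have : Real.exp x ≤ 1 := Real.exp_le_one_iff.mpr h0.le
      nlinarith

/-- The deviation of the number of elements of `F` receiving colour `j` from its mean. -/
noncomputable def colorDev {E : Type*} {k : ℕ} (F : Finset E) (c : E → Fin k) (j : Fin k) : ℝ :=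
  ((F.filter fun e => c e = j).card : ℝ) - F.card / k

lemma colorDev_eq_sum {E : Type*} {k : ℕ} (F : Finset E) (c : E → Fin k) (j : Fin k) :
    colorDev F c j = ∑ e ∈ F, ((if c e = j then (1 : ℝ) else 0) - 1 / k) := by
  rw [colorDev, Finset.sum_sub_distrib, Finset.sum_boole, Finset.sum_const, nsmul_eq_mul]
  ring

lemma sum_exp_indicator_le {k : ℕ} (j : Fin k) (l : ℝ) :
    ∑ a : Fin k, Real.exp (l * ((if a = j then (1 : ℝ) else 0) - 1 / k)) ≤ k * Real.exp (l ^ 2) := by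
  have hk : (1 : ℝ) ≤ k := by exact_mod_cast (Fin.pos j)
  have hk' : (1 : ℝ) / k ≤ 1 := by rw [div_le_one (by linarith)]; exact hk
  have hk0 : (0 : ℝ) ≤ 1 / k := by positivity
  have h : ∀ a : Fin k, Real.exp (l * ((if a = j then (1 : ℝ) else 0) - 1 / k)) ≤
      l * ((if a = j then (1 : ℝ) else 0) - 1 / k) + Real.exp (l ^ 2) := by
    intro a
    refine (exp_le_add_exp_sq _).trans ?_
    refine add_le_add le_rfl (Real.exp_le_exp.mpr ?_)
    rw [mul_pow]
    refine mul_le_of_le_one_right (sq_nonneg _) ?_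
    rw [sq_le_one_iff_abs_le_one, abs_le]
    split_ifs <;> constructor <;> linarith
  refine (Finset.sum_le_sum fun a _ => h a).trans ?_
  rw [Finset.sum_add_distrib, ← Finset.mul_sum, Finset.sum_sub_distrib]
  have : (k : ℝ) * (k : ℝ)⁻¹ = 1 := mul_inv_cancel₀ (by linarith)
  simp [this]

lemma sum_exp_colorDev_le {E : Type*} [Fintype E] {k : ℕ} (F : Finset E) (j : Fin k) (l : ℝ) :
    ∑ c : E → Fin k, Real.exp (l * colorDev F c j) ≤
      (k : ℝ) ^ Fintype.card E * Real.exp (l ^ 2 * F.card) := by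
  have h1 : ∀ c : E → Fin k, Real.exp (l * colorDev F c j) =
      ∏ e, (fun e a => if e ∈ F then Real.exp (l * ((if a = j then (1 : ℝ) else 0) - 1 / k))
        else 1) e (c e) := by
    intro c
    rw [colorDev_eq_sum, Finset.mul_sum, Real.exp_sum, Finset.prod_ite_mem, Finset.univ_inter]
  have h2 := Finset.prod_univ_sum (fun _ : E => (Finset.univ : Finset (Fin k)))
    (fun e a => if e ∈ F then Real.exp (l * ((if a = j then (1 : ℝ) else 0) - 1 / k)) else 1)
  rw [Fintype.piFinset_univ] at h2
  rw [Finset.sum_congr rfl fun c _ => h1 c, ← h2]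
  have h3 : ∀ e ∈ (Finset.univ : Finset E),
      (∑ a : Fin k, if e ∈ F then Real.exp (l * ((if a = j then (1 : ℝ) else 0) - 1 / k)) else 1)
      ≤ k * (if e ∈ F then Real.exp (l ^ 2) else 1) := by
    intro e _
    split_ifs
    · exact sum_exp_indicator_le j l
    · simp
  refine (Finset.prod_le_prod (fun e _ => Finset.sum_nonneg fun a _ => ?_) h3).trans ?_
  · split_ifs <;> positivity
  · rw [Finset.prod_mul_distrib, Finset.prod_ite_mem, Finset.univ_inter, Finset.prod_const,
      Finset.prod_const, ← Real.exp_nat_mul, Finset.card_univ, mul_comm (l ^ 2)]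

/-- A colouring that is simultaneously balanced on every member of a family of sets. -/
theorem exists_balanced_coloring {E ι : Type*} [Fintype E] [Fintype ι] (k : ℕ) (hk : 0 < k)
    (F : ι → Finset E) (N t : ι → ℝ) (hN : ∀ i, 0 < N i) (hF : ∀ i, ((F i).card : ℝ) ≤ N i)
    (ht : ∀ i, 0 ≤ t i) (h : ∑ i, 2 * (k : ℝ) * Real.exp (-(t i ^ 2 / (4 * N i))) < 1) :
    ∃ c : E → Fin k, ∀ i j, |colorDev (F i) c j| ≤ t i := by
  by_contra! hcon
  set l : ι → ℝ := fun i => t i / (2 * N i) with hl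
  have hl0 : ∀ i, 0 ≤ l i := fun i => div_nonneg (ht i) (by linarith [hN i])
  have hk' : (0 : ℝ) < k := by exact_mod_cast hk
  have key : ∀ c : E → Fin k, (1 : ℝ) ≤ ∑ i, ∑ j,
      (Real.exp (l i * colorDev (F i) c j) * Real.exp (-(l i * t i)) +
       Real.exp (-l i * colorDev (F i) c j) * Real.exp (-(l i * t i))) := by
    intro c
    obtain ⟨i, j, hij⟩ := hcon c
    refine le_trans ?_ (Finset.single_le_sum (f := fun i => ∑ j,
      (Real.exp (l i * colorDev (F i) c j) * Real.exp (-(l i * t i)) +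
       Real.exp (-l i * colorDev (F i) c j) * Real.exp (-(l i * t i))))
      (fun i _ => Finset.sum_nonneg fun j _ => by positivity) (Finset.mem_univ i))
    refine le_trans ?_ (Finset.single_le_sum (f := fun j =>
      (Real.exp (l i * colorDev (F i) c j) * Real.exp (-(l i * t i)) +
       Real.exp (-l i * colorDev (F i) c j) * Real.exp (-(l i * t i))))
      (fun j _ => by positivity) (Finset.mem_univ j))
    have hpos : ∀ x : ℝ, 0 < Real.exp x := Real.exp_pos
    rw [← Real.exp_add, ← Real.exp_add]
    rcases le_abs.mp hij.le with hd | hd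
    · have : 1 ≤ Real.exp (l i * colorDev (F i) c j + -(l i * t i)) := by
        rw [Real.one_le_exp_iff]; nlinarith [hl0 i]
      linarith [hpos (-l i * colorDev (F i) c j + -(l i * t i))]
    · have : 1 ≤ Real.exp (-l i * colorDev (F i) c j + -(l i * t i)) := by
        rw [Real.one_le_exp_iff]; nlinarith [hl0 i]
      linarith [hpos (l i * colorDev (F i) c j + -(l i * t i))]
  have hsum := Finset.sum_le_sum fun c (_ : c ∈ (Finset.univ : Finset (E → Fin k))) => key c
  rw [Finset.sum_const, nsmul_eq_mul, mul_one, Finset.card_univ, Fintype.card_fun,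
    Fintype.card_fin, Finset.sum_comm] at hsum
  have hM : (0 : ℝ) < (k : ℝ) ^ Fintype.card E := by positivity
  have hb : ∀ i, ∑ c : E → Fin k, ∑ j,
      (Real.exp (l i * colorDev (F i) c j) * Real.exp (-(l i * t i)) +
       Real.exp (-l i * colorDev (F i) c j) * Real.exp (-(l i * t i))) ≤
      (k : ℝ) ^ Fintype.card E * (2 * (k : ℝ) * Real.exp (-(t i ^ 2 / (4 * N i)))) := by
    intro i
    rw [Finset.sum_comm]
    have hj : ∀ j ∈ (Finset.univ : Finset (Fin k)), ∑ c : E → Fin k,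
        (Real.exp (l i * colorDev (F i) c j) * Real.exp (-(l i * t i)) +
         Real.exp (-l i * colorDev (F i) c j) * Real.exp (-(l i * t i))) ≤
        (k : ℝ) ^ Fintype.card E * (2 * Real.exp (-(t i ^ 2 / (4 * N i)))) := by
      intro j _
      rw [Finset.sum_add_distrib, ← Finset.sum_mul, ← Finset.sum_mul]
      have e1 := sum_exp_colorDev_le (F i) j (l i)
      have e2 := sum_exp_colorDev_le (F i) j (-l i)
      rw [neg_sq] at e2
      have e3 : Real.exp (l i ^ 2 * (F i).card) * Real.exp (-(l i * t i)) ≤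
          Real.exp (-(t i ^ 2 / (4 * N i))) := by
        rw [← Real.exp_add, Real.exp_le_exp]
        have : l i ^ 2 * (F i).card ≤ l i ^ 2 * N i :=
          mul_le_mul_of_nonneg_left (hF i) (sq_nonneg _)
        have e4 : l i ^ 2 * N i + -(l i * t i) = -(t i ^ 2 / (4 * N i)) := by
          have := (hN i).ne'
          simp only [hl]
          field_simp
          ring
        linarith
      have hp := Real.exp_pos (-(l i * t i))
      calc _ ≤ (k : ℝ) ^ Fintype.card E * Real.exp (l i ^ 2 * (F i).card) * Real.exp (-(l i * t i))
          + (k : ℝ) ^ Fintype.card E * Real.exp (l i ^ 2 * (F i).card) * Real.exp (-(l i * t i)) :=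
            add_le_add (mul_le_mul_of_nonneg_right e1 hp.le) (mul_le_mul_of_nonneg_right e2 hp.le)
        _ = (k : ℝ) ^ Fintype.card E *
            (2 * (Real.exp (l i ^ 2 * (F i).card) * Real.exp (-(l i * t i)))) := by ring
        _ ≤ _ := by gcongr
    refine (Finset.sum_le_sum hj).trans (le_of_eq ?_)
    rw [Finset.sum_const, nsmul_eq_mul, Finset.card_univ, Fintype.card_fin]
    ring
  have h2 := hsum.trans (Finset.sum_le_sum fun i _ => hb i)
  rw [← Finset.mul_sum] at h2
  push_cast at h2
  nlinarith

end Coloring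

section Koenig

variable {V : Type*} [Fintype V]

lemma exists_perm_of_regular (A : V → V → ℕ) (D : ℕ) (hD : 0 < D) (hrow : ∀ v, ∑ w, A v w = D)
    (hcol : ∀ w, ∑ v, A v w = D) : ∃ σ : Equiv.Perm V, ∀ v, 0 < A v (σ v) := by
  obtain ⟨f, hf, hf'⟩ := (Finset.all_card_le_biUnion_card_iff_exists_injective
    (fun v => Finset.univ.filter fun w => 0 < A v w)).mp (by
      intro S
      set U := S.biUnion fun v => Finset.univ.filter fun w => 0 < A v w with hU
      have h1 : ∑ v ∈ S, ∑ w ∈ U, A v w = S.card * D := by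
        rw [Finset.sum_congr rfl fun v hv => ?_, Finset.sum_const, smul_eq_mul]
        rw [← hrow v]
        refine Finset.sum_subset (Finset.subset_univ _) fun w _ hw => ?_
        by_contra h0
        exact hw (Finset.mem_biUnion.mpr ⟨v, hv, by simpa using Nat.pos_of_ne_zero h0⟩)
      have h2 : ∑ v ∈ S, ∑ w ∈ U, A v w ≤ U.card * D := by
        rw [Finset.sum_comm, ← smul_eq_mul, ← Finset.sum_const]
        refine Finset.sum_le_sum fun w _ => ?_
        rw [← hcol w]
        exact Finset.sum_le_sum_of_subset (Finset.subset_univ _)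
      exact Nat.le_of_mul_le_mul_right (h1 ▸ h2) hD)
  refine ⟨Equiv.ofBijective f (Finite.injective_iff_bijective.mp hf), fun v => ?_⟩
  simpa using hf' v

lemma exists_perms_of_regular (D : ℕ) : ∀ A : V → V → ℕ, (∀ v, ∑ w, A v w = D) →
    (∀ w, ∑ v, A v w = D) → ∃ σ : ℕ → Equiv.Perm V,
      ∀ v w, ((Finset.range D).filter fun j => σ j v = w).card = A v w := by
  induction D with
  | zero =>
    intro A hrow _
    refine ⟨fun _ => 1, fun v w => ?_⟩
    have := Finset.sum_eq_zero_iff.mp (hrow v) w (Finset.mem_univ _)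
    rw [this, Finset.card_eq_zero, Finset.filter_eq_empty_iff]
    simp
  | succ D ih =>
    intro A hrow hcol
    obtain ⟨τ, hτ⟩ := exists_perm_of_regular A (D + 1) (by omega) hrow hcol
    have hA : ∀ v w, (A v w - if τ v = w then 1 else 0) + (if τ v = w then 1 else 0) = A v w := by
      intro v w
      split_ifs with h
      · have := hτ v
        rw [h] at this
        omega
      · simp
    obtain ⟨σ, hσ⟩ := ih (fun v w => A v w - if τ v = w then 1 else 0) (by
      intro v
      have h := hrow v
      rw [← Finset.sum_congr rfl fun w _ => hA v w, Finset.sum_add_distrib] at h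
      simpa using h) (by
      intro w
      have h := hcol w
      rw [← Finset.sum_congr rfl fun v _ => hA v w, Finset.sum_add_distrib] at h
      have h' : ∑ v, (if τ v = w then 1 else 0) = 1 := by
        rw [Finset.sum_congr rfl fun v _ => if_congr (τ.eq_symm_apply (x := w) (y := v)).symm rfl rfl]
        simp
      rw [h'] at h
      simpa using h)
    refine ⟨Function.update σ D τ, fun v w => ?_⟩
    rw [Finset.range_add_one, Finset.filter_insert, ← hA v w, ← hσ v w]
    have h1 : (Finset.range D).filter (fun j => Function.update σ D τ j v = w) =
        (Finset.range D).filter (fun j => σ j v = w) := by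
      refine Finset.filter_congr fun j hj => ?_
      rw [Function.update_of_ne (Finset.mem_range.mp hj).ne]
    rw [h1, Function.update_self]
    split_ifs with h
    · rw [Finset.card_insert_of_notMem (by simp)]
    · rfl

lemma exists_regular_ge (D d : ℕ) : ∀ A : V → V → ℕ, (∀ v, ∑ w, A v w ≤ D) →
    (∀ w, ∑ v, A v w ≤ D) → ∑ v, ∑ w, A v w + d = Fintype.card V * D →
    ∃ A' : V → V → ℕ, (∀ v w, A v w ≤ A' v w) ∧ (∀ v, ∑ w, A' v w = D) ∧
      ∀ w, ∑ v, A' v w = D := by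
  induction d with
  | zero =>
    intro A hrow hcol h
    have hc : Fintype.card V * D = ∑ _v : V, D := by simp
    refine ⟨A, fun _ _ => le_rfl, ?_, ?_⟩
    · rw [add_zero, hc, Finset.sum_eq_sum_iff_of_le fun v _ => hrow v] at h
      exact fun v => h v (Finset.mem_univ _)
    · rw [add_zero, hc, Finset.sum_comm, Finset.sum_eq_sum_iff_of_le fun v _ => hcol v] at h
      exact fun v => h v (Finset.mem_univ _)
  | succ d ih =>
    intro A hrow hcol h
    have hc : Fintype.card V * D = ∑ _v : V, D := by simp
    obtain ⟨v, -, hv⟩ : ∃ v ∈ Finset.univ, ∑ w, A v w < D :=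
      Finset.exists_lt_of_sum_lt (by rw [← hc]; omega)
    obtain ⟨w, -, hw⟩ : ∃ w ∈ Finset.univ, ∑ v, A v w < D :=
      Finset.exists_lt_of_sum_lt (by rw [← hc, Finset.sum_comm]; omega)
    have e1 : ∀ x, ∑ y, (A x y + if x = v ∧ y = w then 1 else 0) =
        ∑ y, A x y + if x = v then 1 else 0 := by
      intro x
      rw [Finset.sum_add_distrib]
      by_cases hx : x = v <;> simp [hx]
    have e2 : ∀ y, ∑ x, (A x y + if x = v ∧ y = w then 1 else 0) =
        ∑ x, A x y + if y = w then 1 else 0 := by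
      intro y
      rw [Finset.sum_add_distrib]
      by_cases hy : y = w <;> simp [hy]
    obtain ⟨A', h1, h2, h3⟩ := ih (fun x y => A x y + if x = v ∧ y = w then 1 else 0)
      (by
        intro x
        rw [e1]
        split_ifs with hx
        · rw [hx]; omega
        · exact hrow x)
      (by
        intro y
        rw [e2]
        split_ifs with hy
        · rw [hy]; omega
        · exact hcol y)
      (by
        rw [Finset.sum_congr rfl fun x _ => e1 x, Finset.sum_add_distrib]
        simp only [Finset.sum_ite_eq', Finset.mem_univ, if_true]
        omega)
    exact ⟨A', fun x y => (Nat.le_add_right _ _).trans (h1 x y), h2, h3⟩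

/-- A bipartite graph of maximum degree at most `D` is covered by `D` permutations, each edge being
used for real exactly once. -/
theorem exists_perms_of_degree_le (B : V → V → Prop) (D : ℕ)
    (hout : ∀ v, (Finset.univ.filter fun w => B v w).card ≤ D)
    (hin : ∀ w, (Finset.univ.filter fun v => B v w).card ≤ D) :
    ∃ (σ : ℕ → Equiv.Perm V) (real : ℕ → V → Prop),
      (∀ j v, real j v → B v (σ j v)) ∧
      (∀ i j v, i < D → j < D → real i v → real j v → σ i v = σ j v → i = j) ∧
      (∀ v, ((Finset.range D).filter fun j => ¬ real j v).card +
        (Finset.univ.filter fun w => B v w).card = D) ∧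
      ∀ w, ((Finset.range D).filter fun j => ¬ real j ((σ j).symm w)).card +
        (Finset.univ.filter fun v => B v w).card = D := by
  have r1 : ∀ v, ∑ w, (if B v w then 1 else 0) ≤ D := fun v => by
    rw [Finset.sum_boole]; exact hout v
  have r2 : ∀ w, ∑ v, (if B v w then 1 else 0) ≤ D := fun v => by
    rw [Finset.sum_boole]; exact hin v
  have r3 : ∑ v, ∑ w, (if B v w then 1 else 0) ≤ Fintype.card V * D := by
    refine (Finset.sum_le_sum fun v _ => r1 v).trans (by simp)
  obtain ⟨A, hA, hr, hc⟩ := exists_regular_ge D _ (fun v w => if B v w then 1 else 0) r1 r2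
    (Nat.add_sub_cancel' r3)
  obtain ⟨σ, hσ⟩ := exists_perms_of_regular D A hr hc
  have hex : ∀ v w, B v w → ∃ j, j < D ∧ σ j v = w := by
    intro v w h
    have h1 := hA v w
    rw [if_pos h, ← hσ v w] at h1
    obtain ⟨j, hj⟩ := Finset.card_pos.mp h1
    rw [Finset.mem_filter, Finset.mem_range] at hj
    exact ⟨j, hj⟩
  choose! J hJD hJ using hex
  refine ⟨σ, fun j v => B v (σ j v) ∧ J v (σ j v) = j, fun j v h => h.1, ?_, ?_, ?_⟩
  · intro i j v _ _ hi hj h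
    rw [← hi.2, ← hj.2, h]
  · intro v
    have hb : ((Finset.range D).filter fun j => B v (σ j v) ∧ J v (σ j v) = j).card =
        (Finset.univ.filter fun w => B v w).card := by
      refine Finset.card_nbij' (fun j => σ j v) (fun w => J v w) ?_ ?_ ?_ ?_
      · intro j hj
        simp only [Finset.coe_filter, Set.mem_ofPred_eq, Finset.mem_range] at hj
        simpa using hj.2.1
      · intro w hw
        simp only [Finset.coe_filter, Set.mem_ofPred_eq, Finset.mem_univ, true_and] at hw
        simp only [Finset.coe_filter, Set.mem_ofPred_eq, Finset.mem_range, hJ v w hw]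
        exact ⟨hJD v w hw, hw, trivial⟩
      · intro j hj
        simp only [Finset.coe_filter, Set.mem_ofPred_eq, Finset.mem_range] at hj
        exact hj.2.2
      · intro w hw
        simp only [Finset.coe_filter, Set.mem_ofPred_eq, Finset.mem_univ, true_and] at hw
        exact hJ v w hw
    rw [← hb, add_comm, Finset.card_filter_add_card_filter_not, Finset.card_range]
  · intro w
    simp only [Equiv.apply_symm_apply]
    have hb : ((Finset.range D).filter fun j => B ((σ j).symm w) w ∧ J ((σ j).symm w) w = j).card =
        (Finset.univ.filter fun v => B v w).card := by
      have hs : ∀ v, B v w → (σ (J v w)).symm w = v := fun v hv => by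
        rw [Equiv.symm_apply_eq]; exact (hJ v w hv).symm
      refine Finset.card_nbij' (fun j => (σ j).symm w) (fun v => J v w) ?_ ?_ ?_ ?_
      · intro j hj
        simp only [Finset.coe_filter, Set.mem_ofPred_eq, Finset.mem_range] at hj
        simpa using hj.2.1
      · intro v hv
        simp only [Finset.coe_filter, Set.mem_ofPred_eq, Finset.mem_univ, true_and] at hv
        simp only [Finset.coe_filter, Set.mem_ofPred_eq, Finset.mem_range, hs v hv]
        exact ⟨hJD v w hv, hv, trivial⟩
      · intro j hj
        simp only [Finset.coe_filter, Set.mem_ofPred_eq, Finset.mem_range] at hj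
        exact hj.2.2
      · intro v hv
        simp only [Finset.coe_filter, Set.mem_ofPred_eq, Finset.mem_univ, true_and] at hv
        exact hs v hv
    rw [← hb, add_comm, Finset.card_filter_add_card_filter_not, Finset.card_range]

end Koenig

section Rounds

lemma card_filter_natCast_le (k : ℕ) [NeZero k] (a : ZMod k) (D : ℕ) :
    ((Finset.range D).filter fun t : ℕ => (t : ZMod k) = a).card ≤ D / k + 1 := by
  rw [← Finset.card_range (D / k + 1)]
  refine Finset.card_le_card_of_injOn (fun t => t / k) ?_ ?_
  · intro t ht
    simp only [Finset.coe_filter, Set.mem_ofPred_eq, Finset.mem_range] at ht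
    simp only [Finset.coe_range, Set.mem_Iio]
    exact Nat.lt_succ_of_le (Nat.div_le_div_right ht.1.le)
  · intro t ht t' ht' h
    simp only [Finset.coe_filter, Set.mem_ofPred_eq, Finset.mem_range] at ht ht'
    have h1 : t % k = t' % k := (ZMod.natCast_eq_natCast_iff t t' k).mp (ht.2.trans ht'.2.symm)
    simp only at h
    rw [← Nat.div_add_mod t k, ← Nat.div_add_mod t' k, h, h1]

lemma card_filter_range_mul_le (m D Q : ℕ) (P : ℕ → ℕ → Prop) [∀ s t, Decidable (P s t)]
    (h : ∀ s < m, ((Finset.range D).filter fun t => P s t).card ≤ Q) :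
    ((Finset.range (m * D)).filter fun j => P (j / D) (j % D)).card ≤ Q * m := by
  rcases Nat.eq_zero_or_pos D with rfl | hD
  · simp
  nth_rewrite 2 [← Finset.card_range m]
  refine Finset.card_le_mul_card_image_of_maps_to (f := fun j => j / D) ?_ Q ?_
  · intro j hj
    rw [Finset.mem_filter, Finset.mem_range] at hj
    exact Finset.mem_range.mpr ((Nat.div_lt_iff_lt_mul hD).mpr hj.1)
  · intro s hs
    refine le_trans (Finset.card_le_card_of_injOn (fun j => j % D) ?_ ?_)
      (h s (Finset.mem_range.mp hs))
    · intro j hj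
      simp only [Finset.coe_filter, Set.mem_ofPred_eq, Finset.mem_filter, Finset.mem_range] at hj ⊢
      refine ⟨Nat.mod_lt _ hD, ?_⟩
      rw [← hj.2]
      exact hj.1.2
    · intro j hj j' hj' hjj
      simp only [Finset.coe_filter, Set.mem_ofPred_eq, Finset.mem_filter] at hj hj'
      simp only at hjj
      rw [← Nat.div_add_mod j D, ← Nat.div_add_mod j' D, hj.2, hj'.2, hjj]

/-- Edge-disjoint full cycles in `G`, up to a small exceptional set of vertices in each cycle,
obtained from a colouring for which all the colour-shift subgraphs of `G` are nearly regular. -/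
theorem exists_approx_full_cycles {V : Type*} [Fintype V] [DecidableEq V] (k : ℕ)
    [Fact k.Prime] (G : V → V → Prop) (c : V → ZMod k) (D τ : ℕ)
    (hout : ∀ s ≠ 0, ∀ v, (Finset.univ.filter fun w => G v w ∧ c w = c v + s).card ≤ D ∧
      D ≤ (Finset.univ.filter fun w => G v w ∧ c w = c v + s).card + τ)
    (hin : ∀ s ≠ 0, ∀ w, (Finset.univ.filter fun v => G v w ∧ c w = c v + s).card ≤ D ∧
      D ≤ (Finset.univ.filter fun v => G v w ∧ c w = c v + s).card + τ) :
    ∃ (σ : ℕ → Equiv.Perm V) (B : ℕ → Finset V), (∀ j < (k - 1) * D, IsFullCycle (σ j)) ∧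
      (∀ j < (k - 1) * D, ∀ v ∉ B j, G v (σ j v)) ∧
      (∀ i j, i < j → j < (k - 1) * D → ∀ v ∉ B i, v ∉ B j → σ i v ≠ σ j v) ∧
      (∀ v, ((Finset.range ((k - 1) * D)).filter fun j => v ∈ B j).card ≤
        (τ + (D / k + 1)) * (k - 1)) ∧
      ∀ w, ((Finset.range ((k - 1) * D)).filter fun j => (σ j).symm w ∈ B j).card ≤
        (τ + (D / k + 1)) * (k - 1) := by
  have hk := (Fact.out : k.Prime).two_le
  obtain ⟨Gs, hGs⟩ : ∃ Gs : ZMod k → V → V → Prop,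
      ∀ s v w, Gs s v w ↔ G v w ∧ c w = c v + s := ⟨_, fun _ _ _ => Iff.rfl⟩
  have hcout : ∀ s v, (Finset.univ.filter fun w => G v w ∧ c w = c v + s).card =
      (Finset.univ.filter fun w => Gs s v w).card := by
    intro s v
    congr 1
    ext w
    simp [hGs]
  have hcin : ∀ s w, (Finset.univ.filter fun v => G v w ∧ c w = c v + s).card =
      (Finset.univ.filter fun v => Gs s v w).card := by
    intro s v
    congr 1
    ext w
    simp [hGs]
  simp only [hcout] at hout
  simp only [hcin] at hin
  have hdec := fun (s : ZMod k) (hs : s ≠ 0) =>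
    exists_perms_of_degree_le (Gs s) D (fun v => (hout s hs v).1) fun v => (hin s hs v).1
  choose! π real hreal huniq hno hni using hdec
  simp only [hGs] at hreal
  have hs0 : ∀ s < k - 1, ((s + 1 : ℕ) : ZMod k) ≠ 0 := by
    intro s hs h
    rw [ZMod.natCast_eq_zero_iff] at h
    exact absurd (Nat.le_of_dvd (by omega) h) (by omega)
  obtain ⟨Bd, hBd⟩ : ∃ Bd : ZMod k → ℕ → Finset V,
      ∀ s t v, v ∈ Bd s t ↔ ¬ real s t v ∨ c v = t :=
    ⟨fun s t => Finset.univ.filter fun v => ¬ real s t v ∨ c v = t, fun s t v => by simp⟩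
  have hmeet : ∀ s : ZMod k, s ≠ 0 → ∀ t v, ∃ m : ℕ, (π s t ^ m) v ∈ Bd s t := by
    intro s hs t v
    by_contra! hcon
    have hstep : ∀ m : ℕ, c ((π s t ^ m) v) = c v + m * s := by
      intro m
      induction m with
      | zero => simp
      | succ m ih =>
        have h := hcon m
        rw [hBd, not_or, not_not] at h
        rw [pow_succ', Equiv.Perm.mul_apply, (hreal s hs t _ h.1).2, ih]
        push_cast
        ring
    have h := hcon (((t : ZMod k) - c v) / s).val
    rw [hBd, not_or, hstep, ZMod.natCast_zmod_val, div_mul_cancel₀ _ hs] at h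
    exact h.2 (by ring)
  have hagree := fun (s : ZMod k) (hs : s ≠ 0) (t : ℕ) =>
    exists_isFullCycle_agree (π s t) (Bd s t) (hmeet s hs t)
  choose! σ hσfull hσ using hagree
  have hDpos : ∀ j, j < (k - 1) * D → 0 < D := fun j hj =>
    Nat.pos_of_ne_zero fun h => by simp [h] at hj
  have hdiv : ∀ j, j < (k - 1) * D → j / D < k - 1 := fun j hj =>
    (Nat.div_lt_iff_lt_mul (hDpos j hj)).mpr hj
  refine ⟨fun j => σ ((j / D + 1 : ℕ) : ZMod k) (j % D),
    fun j => Bd ((j / D + 1 : ℕ) : ZMod k) (j % D), ?_, ?_, ?_, ?_, ?_⟩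
  · exact fun j hj => hσfull _ (hs0 _ (hdiv j hj)) _
  · intro j hj v hv
    have h0 := hs0 _ (hdiv j hj)
    simp only at hv ⊢
    rw [hσ _ h0 _ v hv]
    rw [hBd, not_or, not_not] at hv
    exact (hreal _ h0 _ _ hv.1).1
  · intro i j hij hj v hvi hvj h
    have hi := hij.trans hj
    have hi0 := hs0 _ (hdiv i hi)
    have hj0 := hs0 _ (hdiv j hj)
    simp only at hvi hvj h
    rw [hσ _ hi0 _ v hvi, hσ _ hj0 _ v hvj] at h
    rw [hBd, not_or, not_not] at hvi hvj
    have h1 := (hreal _ hi0 _ _ hvi.1).2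
    have h2 := (hreal _ hj0 _ _ hvj.1).2
    rw [h, h2] at h1
    have h3 := (ZMod.natCast_eq_natCast_iff' _ _ _).mp (add_left_cancel h1)
    have h4 := hdiv i hi
    have h5 := hdiv j hj
    rw [Nat.mod_eq_of_lt (by omega), Nat.mod_eq_of_lt (by omega)] at h3
    rw [h3] at h hvj
    have hD := hDpos j hj
    have h6 := huniq _ hi0 _ _ v (Nat.mod_lt _ hD) (Nat.mod_lt _ hD) hvi.1 hvj.1 h
    have h7 : i = j := by
      rw [← Nat.div_add_mod i D, ← Nat.div_add_mod j D, h6, show i / D = j / D by omega]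
    omega
  · intro v
    simp only
    refine card_filter_range_mul_le (k - 1) D _
      (fun s t => v ∈ Bd ((s + 1 : ℕ) : ZMod k) t) fun s hs => ?_
    have h0 := hs0 s hs
    refine le_trans (Finset.card_le_card (t := ((Finset.range D).filter fun t =>
      ¬ real ((s + 1 : ℕ) : ZMod k) t v) ∪ (Finset.range D).filter fun t : ℕ => (t : ZMod k) = c v) ?_)
      ((Finset.card_union_le _ _).trans (add_le_add ?_ (card_filter_natCast_le k _ D)))
    · intro t ht
      rw [Finset.mem_filter, hBd] at ht
      rw [Finset.mem_union, Finset.mem_filter, Finset.mem_filter]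
      exact ht.2.imp (fun h => ⟨ht.1, h⟩) fun h => ⟨ht.1, h.symm⟩
    · have h1 := hno _ h0 v
      have h2 := (hout _ h0 v).2
      omega
  · intro w
    refine le_trans (Finset.card_le_card ?_) (card_filter_range_mul_le (k - 1) D
      (τ + (D / k + 1)) (fun s t => (π ((s + 1 : ℕ) : ZMod k) t).symm w ∈ Bd ((s + 1 : ℕ) : ZMod k) t)
      fun s hs => ?_)
    · intro j hj
      rw [Finset.mem_filter, Finset.mem_range] at hj ⊢
      refine ⟨hj.1, ?_⟩
      have h0 := hs0 _ (hdiv j hj.1)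
      by_contra hcon
      have h1 := hσ _ h0 _ _ hcon
      rw [Equiv.apply_symm_apply, ← Equiv.eq_symm_apply] at h1
      rw [h1] at hcon
      exact hcon hj.2
    have h0 := hs0 s hs
    refine le_trans (Finset.card_le_card (t := ((Finset.range D).filter fun t =>
      ¬ real ((s + 1 : ℕ) : ZMod k) t ((π ((s + 1 : ℕ) : ZMod k) t).symm w)) ∪
        (Finset.range D).filter fun t : ℕ => (t : ZMod k) = c w - ((s + 1 : ℕ) : ZMod k)) ?_)
      ((Finset.card_union_le _ _).trans (add_le_add ?_ (card_filter_natCast_le k _ D)))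
    · intro t ht
      rw [Finset.mem_filter, hBd] at ht
      rw [Finset.mem_union, Finset.mem_filter, Finset.mem_filter]
      by_cases hr : real ((s + 1 : ℕ) : ZMod k) t ((π ((s + 1 : ℕ) : ZMod k) t).symm w)
      · right
        refine ⟨ht.1, ?_⟩
        have h1 := (hreal _ h0 _ _ hr).2
        rw [Equiv.apply_symm_apply, ht.2.resolve_left (not_not.mpr hr)] at h1
        rw [h1]
        ring
      · exact Or.inl ⟨ht.1, hr⟩
    · have h1 := hni _ h0 w
      have h2 := (hin _ h0 w).2
      omega

end Rounds

section Absorb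

lemma IsFullCycle.isHamCycle {V : Type*} [Fintype V] [DecidableEq V] [Nonempty V]
    {σ : Equiv.Perm V} (hσ : IsFullCycle σ) {G : V → V → Prop} (hG : ∀ v, ¬ G v v)
    (h : ∀ v, G v (σ v)) : IsHamCycle G σ := by
  have hne : ∀ v, σ v ≠ v := fun v hv => hG v (by simpa [hv] using h v)
  obtain ⟨x⟩ := ‹Nonempty V›
  exact ⟨⟨x, hne x, fun y _ => hσ x y⟩, hne, h⟩

lemma card_filter_le_add {V : Type*} [Fintype V] (P Q : V → Prop) (T : Finset V) :
    (T.filter P).card ≤ (T.filter Q).card + (Finset.univ.filter fun v => P v ∧ ¬ Q v).card := by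
  refine (Finset.card_le_card ?_).trans (Finset.card_union_le _ _)
  intro v hv
  rw [Finset.mem_filter] at hv
  by_cases hQ : Q v
  · exact Finset.mem_union_left _ (Finset.mem_filter.mpr ⟨hv.1, hQ⟩)
  · exact Finset.mem_union_right _ (Finset.mem_filter.mpr ⟨Finset.mem_univ _, hv.2, hQ⟩)

lemma edgeCount_le_add {V : Type*} [Fintype V] (H H' : V → V → Prop) (X : ℕ)
    (h : ∀ a, (Finset.univ.filter fun b => H a b ∧ ¬ H' a b).card ≤ X) (S T : Finset V) :
    edgeCount H S T ≤ edgeCount H' S T + X * Fintype.card V := by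
  rw [edgeCount_eq_sum, edgeCount_eq_sum]
  calc _ ≤ ∑ a ∈ S, ((T.filter fun b => H' a b).card + X) := Finset.sum_le_sum fun a _ =>
        (card_filter_le_add (H a) (H' a) T).trans (add_le_add le_rfl (h a))
    _ = ∑ a ∈ S, (T.filter fun b => H' a b).card + S.card * X := by
        rw [Finset.sum_add_distrib, Finset.sum_const, smul_eq_mul]
    _ ≤ _ := by
        rw [mul_comm S.card]
        exact add_le_add le_rfl (Nat.mul_le_mul_left _ (Finset.card_le_univ _))

/-- Almost Hamilton cycles of an oriented graph can be completed to edge-disjoint Hamilton cycles by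
means of a reserved spanning subgraph `H` in which every pair of vertex sets has about the
expected number of edges. -/
theorem exists_hamCycles_of_approx (K : ℝ) (hK : 1 ≤ K) : ∃ c₃ : ℝ, 0 < c₃ ∧ ∃ n₁ : ℕ,
    ∀ (V : Type) [Fintype V] [DecidableEq V], n₁ ≤ Fintype.card V → 0 < Fintype.card V →
    ∀ (G H G' : V → V → Prop), (∀ v, ¬ G v v) → (∀ u v, G u v → ¬ G v u) →
    (∀ v, 499 / 1000 * (Fintype.card V : ℝ) ≤ outDeg G v ∧
      499 / 1000 * (Fintype.card V : ℝ) ≤ inDeg G v) →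
    (∀ u v, H u v → G u v) → (∀ u v, G' u v → G u v ∧ ¬ H u v) →
    ∀ (R L Q T : ℕ), 0 < L → (T : ℝ) ≤ c₃ * Fintype.card V → 55 * (Fintype.card V * Q) ≤ T * L →
    (∀ v, 1 / (4 * K) * (Fintype.card V : ℝ) + (Q + L : ℕ) ≤ outDeg H v ∧
      1 / (4 * K) * (Fintype.card V : ℝ) + (Q + L : ℕ) ≤ inDeg H v) →
    (∀ S T, edgeCount G S T / K - 1 / (4000 * K ^ 2) * (Fintype.card V : ℝ) ^ 2 ≤
      (edgeCount H S T : ℝ) - (Q + L : ℕ) * Fintype.card V) →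
    ∀ (σ : ℕ → Equiv.Perm V) (B : ℕ → Finset V), (∀ j < R, IsFullCycle (σ j)) →
    (∀ j < R, ∀ v ∉ B j, G' v (σ j v)) →
    (∀ i j, i < j → j < R → ∀ v ∉ B i, v ∉ B j → σ i v ≠ σ j v) →
    (∀ v, ((Finset.range R).filter fun j => v ∈ B j).card ≤ Q) →
    (∀ w, ((Finset.range R).filter fun j => (σ j).symm w ∈ B j).card ≤ Q) →
    ∃ Hs : Finset (Equiv.Perm V), (∀ σ ∈ Hs, IsHamCycle G σ) ∧
        (∀ σ ∈ Hs, ∀ τ ∈ Hs, σ ≠ τ → ∀ v : V, σ v ≠ τ v) ∧ Hs.card = R := by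
  obtain ⟨c₃, hc₃, n₁, hfix⟩ := exists_isFullCycle_fix
    (1 / (4000 * K) * (1 / (4000 * K ^ 2)) ^ 2) (by positivity)
  refine ⟨c₃, hc₃, n₁, ?_⟩
  intro V _ _ hn hn0 G H G' hirr hG hdeg hHG hG' R L Q T hL hT hQT hH hHe σ₀ B hσ₀ hB hdisj hout hin
  have hne : Nonempty V := Fintype.card_pos_iff.mp hn0
  obtain ⟨σ, C, hrep, hrepdisj⟩ := exists_repairs H R L (Q + L) T hL σ₀ B hσ₀ (by
      intro H' hH' ho hi Dp Dm hDp hDm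
      refine hfix V hn H' (card_walks_ge G H' hG K hK hdeg ?_ ?_) Dp Dm
        (le_trans (by exact_mod_cast hDp) hT) (le_trans (by exact_mod_cast hDm) hT)
      · intro v
        have h1 : outDeg H v ≤ outDeg H' v + (Q + L) :=
          (card_filter_le_add (fun b => H v b) (fun b => H' v b) Finset.univ).trans
            (add_le_add le_rfl (ho v))
        have h2 : inDeg H v ≤ inDeg H' v + (Q + L) :=
          (card_filter_le_add (fun b => H b v) (fun b => H' b v) Finset.univ).trans
            (add_le_add le_rfl (hi v))
        have h1' : (outDeg H v : ℝ) ≤ outDeg H' v + (Q + L : ℕ) := by exact_mod_cast h1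
        have h2' : (inDeg H v : ℝ) ≤ inDeg H' v + (Q + L : ℕ) := by exact_mod_cast h2
        exact ⟨by linarith [(hH v).1], by linarith [(hH v).2]⟩
      · intro S T
        have h1 : (edgeCount H S T : ℝ) ≤ edgeCount H' S T + (Q + L : ℕ) * Fintype.card V := by
          exact_mod_cast edgeCount_le_add H H' (Q + L) ho S T
        linarith [hHe S T])
    (fun v => add_le_add (hout v) le_rfl) (fun v => add_le_add (hin v) le_rfl) (by
      refine le_trans (Nat.mul_le_mul_left _ ?_) hQT
      have h3 : ∑ j ∈ Finset.range R, (B j).card =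
          ∑ v, ((Finset.range R).filter fun j => v ∈ B j).card := by
        simp only [Finset.card_filter]
        rw [Finset.sum_comm]
        refine Finset.sum_congr rfl fun j _ => ?_
        simp
      rw [h3]
      refine (Finset.sum_le_sum fun v _ => hout v).trans ?_
      simp)
  have hedge : ∀ j < R, ∀ v, G v (σ j v) := by
    intro j hj v
    by_cases hv : v ∈ C j
    · exact hHG _ _ ((hrep j hj).edge v hv)
    · rw [(hrep j hj).agree v hv]
      exact (hG' _ _ (hB j hj v fun h => hv ((hrep j hj).subset h))).1
  have hd : ∀ i j, i < j → j < R → ∀ v, σ i v ≠ σ j v := by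
    intro i j hij hj v
    have hi := hij.trans hj
    by_cases hvi : v ∈ C i <;> by_cases hvj : v ∈ C j
    · exact hrepdisj i j hij hj v hvi hvj
    · intro h
      have h1 := (hrep i hi).edge v hvi
      rw [h, (hrep j hj).agree v hvj] at h1
      exact (hG' _ _ (hB j hj v fun h => hvj ((hrep j hj).subset h))).2 h1
    · intro h
      have h1 := (hrep j hj).edge v hvj
      rw [← h, (hrep i hi).agree v hvi] at h1
      exact (hG' _ _ (hB i hi v fun h => hvi ((hrep i hi).subset h))).2 h1
    · rw [(hrep i hi).agree v hvi, (hrep j hj).agree v hvj]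
      exact hdisj i j hij hj v (fun h => hvi ((hrep i hi).subset h))
        fun h => hvj ((hrep j hj).subset h)
  have hd' : ∀ i j, i < R → j < R → i ≠ j → ∀ v, σ i v ≠ σ j v := by
    intro i j hi hj hij v
    rcases lt_or_gt_of_ne hij with h | h
    · exact hd i j h hj v
    · exact (hd j i h hi v).symm
  refine ⟨(Finset.range R).image σ, ?_, ?_, ?_⟩
  · intro τ hτ
    obtain ⟨j, hj, rfl⟩ := Finset.mem_image.mp hτ
    have hj := Finset.mem_range.mp hj
    exact (hrep j hj).full.isHamCycle hirr (hedge j hj)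
  · intro τ hτ τ' hτ' hne'
    obtain ⟨i, hi, rfl⟩ := Finset.mem_image.mp hτ
    obtain ⟨j, hj, rfl⟩ := Finset.mem_image.mp hτ'
    exact hd' i j (Finset.mem_range.mp hi) (Finset.mem_range.mp hj) fun h => hne' (by rw [h])
  · rw [Finset.card_image_of_injOn, Finset.card_range]
    intro i hi j hj hij
    by_contra hne'
    obtain ⟨v⟩ := hne
    exact hd' i j (Finset.mem_range.mp hi) (Finset.mem_range.mp hj) hne' v (by rw [hij])

end Absorb

section Random

lemma exists_nat_exp_small (a K : ℝ) (ha : 0 < a) (hK : 0 < K) : ∃ N : ℕ, 0 < N ∧ ∀ n : ℕ, N ≤ n →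
    4 * K * n * Real.exp (-(a * n)) + 2 * K * 4 ^ n * Real.exp (-(a * n ^ 2)) < 1 := by
  obtain ⟨N, hN⟩ := exists_nat_ge (8 * K / a ^ 2 + 2 * K + 3 / a)
  refine ⟨N + 1, by omega, fun n hn => ?_⟩
  have hn1 : (N : ℝ) + 1 ≤ n := by exact_mod_cast hn
  have p1 : 0 < 8 * K / a ^ 2 := by positivity
  have p2 : 0 < 3 / a := by positivity
  have hn0 : (0 : ℝ) < n := by linarith
  have h3 : 3 ≤ a * n := by
    have : 3 / a ≤ n := by linarith
    rw [div_le_iff₀ ha] at this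
    linarith
  have e1 : Real.exp (-(a * n)) ≤ 2 / (a * n) ^ 2 := by
    rw [Real.exp_neg, inv_le_comm₀ (Real.exp_pos _) (by positivity), inv_div]
    have := Real.quadratic_le_exp_of_nonneg (x := a * n) (by positivity)
    nlinarith
  have e2 : (4 : ℝ) ^ n * Real.exp (-(a * n ^ 2)) ≤ 1 / n := by
    have h4 : (4 : ℝ) ≤ Real.exp 2 := by
      have := Real.quadratic_le_exp_of_nonneg (x := 2) (by norm_num)
      linarith
    have h5 : (4 : ℝ) ^ n ≤ Real.exp (2 * n) := by
      rw [mul_comm, Real.exp_nat_mul]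
      exact pow_le_pow_left₀ (by norm_num) h4 n
    calc (4 : ℝ) ^ n * Real.exp (-(a * n ^ 2)) ≤ Real.exp (2 * n) * Real.exp (-(a * n ^ 2)) := by
          gcongr
      _ = Real.exp (2 * n - a * n ^ 2) := by rw [← Real.exp_add]; ring_nf
      _ ≤ Real.exp (-n) := Real.exp_le_exp.mpr (by nlinarith)
      _ ≤ 1 / n := by
          rw [Real.exp_neg, one_div, inv_le_inv₀ (Real.exp_pos _) hn0]
          linarith [Real.add_one_le_exp (n : ℝ)]
  have e3 : 4 * K * n * Real.exp (-(a * n)) ≤ 8 * K / a ^ 2 / n := by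
    refine (mul_le_mul_of_nonneg_left e1 (by positivity)).trans (le_of_eq ?_)
    field_simp
    ring
  have e4 : 2 * K * 4 ^ n * Real.exp (-(a * n ^ 2)) ≤ 2 * K / n := by
    rw [mul_assoc]
    refine (mul_le_mul_of_nonneg_left e2 (by positivity)).trans (le_of_eq ?_)
    ring
  have e5 : 8 * K / a ^ 2 / n + 2 * K / n < 1 := by
    rw [← add_div, div_lt_one hn0]
    linarith
  linarith

lemma edgeCount_singleton_univ {V : Type*} [Fintype V] (G : V → V → Prop) (v : V) :
    edgeCount G {v} Finset.univ = outDeg G v := by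
  rw [edgeCount_eq_sum, Finset.sum_singleton, outDeg]

lemma edgeCount_univ_singleton {V : Type*} [Fintype V] (G : V → V → Prop) (v : V) :
    edgeCount G Finset.univ {v} = inDeg G v := by
  rw [← edgeCount_flip, edgeCount_eq_sum, Finset.sum_singleton, inDeg]

/-- Every dense digraph has a spanning subgraph containing about a `1 / K` proportion of the edges
at each vertex and between any two vertex sets. -/
theorem exists_proportional_subgraph (K : ℕ) (hK : 0 < K) (γ : ℝ) (hγ : 0 < γ) : ∃ N : ℕ,
    ∀ (V : Type) [Fintype V], N ≤ Fintype.card V → ∀ G : V → V → Prop,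
    ∃ H : V → V → Prop, (∀ u v, H u v → G u v) ∧
      (∀ v, |(outDeg H v : ℝ) - outDeg G v / K| ≤ γ * Fintype.card V) ∧
      (∀ v, |(inDeg H v : ℝ) - inDeg G v / K| ≤ γ * Fintype.card V) ∧
      ∀ S T, |(edgeCount H S T : ℝ) - edgeCount G S T / K| ≤ γ * (Fintype.card V : ℝ) ^ 2 := by
  have hK' : (0 : ℝ) < K := by exact_mod_cast hK
  obtain ⟨N, hN0, hN⟩ := exists_nat_exp_small (γ ^ 2 / 4) K (by positivity) hK'
  refine ⟨N, fun V _ hn G => ?_⟩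
  have hsmall := hN _ hn
  have hn0 : (0 : ℝ) < Fintype.card V := by exact_mod_cast hN0.trans_le hn
  set n := Fintype.card V with hndef
  obtain ⟨F, hF⟩ : ∃ F : Finset V × Finset V → Finset (V × V),
      ∀ p, F p = (p.1 ×ˢ p.2).filter fun e => G e.1 e.2 := ⟨_, fun _ => rfl⟩
  have hFcard : ∀ p, (F p).card = edgeCount G p.1 p.2 := fun p => by rw [hF]; rfl
  obtain ⟨c, hc⟩ := exists_balanced_coloring (E := V × V) (ι := (V ⊕ V) ⊕ (Finset V × Finset V)) K hK
    (Sum.elim (Sum.elim (fun v => F ({v}, Finset.univ)) fun v => F (Finset.univ, {v})) F)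
    (Sum.elim (fun _ => (n : ℝ)) fun _ => (n : ℝ) ^ 2)
    (Sum.elim (fun _ => γ * n) fun _ => γ * (n : ℝ) ^ 2)
    (by rintro (_ | _) <;> simp only [Sum.elim_inl, Sum.elim_inr] <;> positivity)
    (by
      have h1 : ∀ p, ((F p).card : ℝ) ≤ p.1.card * p.2.card := fun p => by
        rw [hFcard]; exact_mod_cast edgeCount_le_mul G p.1 p.2
      rintro ((v | v) | p)
      · simpa using h1 ({v}, Finset.univ)
      · simpa using h1 (Finset.univ, {v})
      · refine (h1 p).trans ?_
        have h2 : (p.1.card : ℝ) ≤ n := by exact_mod_cast Finset.card_le_univ _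
        have h3 : (p.2.card : ℝ) ≤ n := by exact_mod_cast Finset.card_le_univ _
        simp only [Sum.elim_inr, sq]
        gcongr)
    (by rintro (_ | _) <;> simp only [Sum.elim_inl, Sum.elim_inr] <;> positivity)
    (by
      rw [Fintype.sum_sum_type]
      simp only [Sum.elim_inl, Sum.elim_inr, Finset.sum_const, Finset.card_univ, Fintype.card_sum,
        Fintype.card_prod, Fintype.card_finset, nsmul_eq_mul]
      rw [← hndef]
      have e1 : (γ * (n : ℝ)) ^ 2 / (4 * n) = γ ^ 2 / 4 * n := by field_simp
      have e2 : (γ * (n : ℝ) ^ 2) ^ 2 / (4 * n ^ 2) = γ ^ 2 / 4 * n ^ 2 := by field_simp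
      rw [e1, e2]
      push_cast
      rw [← mul_pow, show (2 : ℝ) * 2 = 4 by norm_num]
      linarith)
  obtain ⟨H, hH⟩ : ∃ H : V → V → Prop, ∀ u v, H u v ↔ G u v ∧ c (u, v) = ⟨0, hK⟩ :=
    ⟨_, fun _ _ => Iff.rfl⟩
  have hdev : ∀ S T, colorDev (F (S, T)) c ⟨0, hK⟩ =
      (edgeCount H S T : ℝ) - edgeCount G S T / K := by
    intro S T
    rw [colorDev, hFcard, hF, Finset.filter_filter]
    congr 2
    rw [edgeCount]
    congr 1
    ext ⟨u, v⟩
    simp [hH]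
  refine ⟨H, fun u v h => ((hH u v).mp h).1, ?_, ?_, ?_⟩
  · intro v
    rw [← edgeCount_singleton_univ, ← edgeCount_singleton_univ, ← hdev]
    exact hc (Sum.inl (Sum.inl v)) _
  · intro v
    rw [← edgeCount_univ_singleton, ← edgeCount_univ_singleton, ← hdev]
    exact hc (Sum.inl (Sum.inr v)) _
  · intro S T
    rw [← hdev]
    exact hc (Sum.inr (S, T)) _

/-- The vertices of a large digraph can be coloured so that the out- and inneighbourhoods of all
vertices are split about equally. -/
theorem exists_balanced_vertex_coloring (k : ℕ) [NeZero k] (γ : ℝ) (hγ : 0 < γ) : ∃ N : ℕ,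
    ∀ (V : Type) [Fintype V], N ≤ Fintype.card V → ∀ G : V → V → Prop,
    ∃ c : V → ZMod k, ∀ a v,
      |((Finset.univ.filter fun w => G v w ∧ c w = a).card : ℝ) - outDeg G v / k| ≤
        γ * Fintype.card V ∧
      |((Finset.univ.filter fun w => G w v ∧ c w = a).card : ℝ) - inDeg G v / k| ≤
        γ * Fintype.card V := by
  have hk : 0 < k := Nat.pos_of_ne_zero (NeZero.ne k)
  have hk' : (0 : ℝ) < k := by exact_mod_cast hk
  obtain ⟨N, hN0, hN⟩ := exists_nat_exp_small (γ ^ 2 / 4) k (by positivity) hk'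
  refine ⟨N, fun V _ hn G => ?_⟩
  have hsmall := hN _ hn
  have hn0 : (0 : ℝ) < Fintype.card V := by exact_mod_cast hN0.trans_le hn
  set n := Fintype.card V with hndef
  obtain ⟨c, hc⟩ := exists_balanced_coloring (E := V) (ι := V ⊕ V) k hk
    (Sum.elim (fun v => Finset.univ.filter fun w => G v w)
      fun v => Finset.univ.filter fun w => G w v)
    (fun _ => (n : ℝ)) (fun _ => γ * n) (fun _ => hn0)
    (by
      have h1 : ∀ s : Finset V, (s.card : ℝ) ≤ n := fun s => by
        exact_mod_cast Finset.card_le_univ s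
      exact fun _ => h1 _)
    (fun _ => by positivity)
    (by
      simp only [Finset.sum_const, Finset.card_univ, Fintype.card_sum, nsmul_eq_mul]
      rw [← hndef]
      have e1 : (γ * (n : ℝ)) ^ 2 / (4 * n) = γ ^ 2 / 4 * n := by field_simp
      rw [e1]
      push_cast
      have e2 : 0 < 2 * (k : ℝ) * 4 ^ n * Real.exp (-(γ ^ 2 / 4 * n ^ 2)) := by positivity
      linarith)
  refine ⟨fun v => ZMod.finEquiv k (c v), fun a v => ⟨?_, ?_⟩⟩
  · have h := hc (Sum.inl v) ((ZMod.finEquiv k).symm a)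
    rw [colorDev, Sum.elim_inl, Finset.filter_filter] at h
    convert h using 5
    · ext w
      rw [Finset.mem_filter, Finset.mem_filter, RingEquiv.eq_symm_apply]
    · rfl
  · have h := hc (Sum.inr v) ((ZMod.finEquiv k).symm a)
    rw [colorDev, Sum.elim_inr, Finset.filter_filter] at h
    convert h using 5
    · ext w
      rw [Finset.mem_filter, Finset.mem_filter, RingEquiv.eq_symm_apply]
    · rfl

end Random

section Main

lemma outDeg_add_inDeg_le {V : Type*} [Fintype V] (G : V → V → Prop)
    (hG : ∀ u v, G u v → ¬ G v u) (v : V) : outDeg G v + inDeg G v ≤ Fintype.card V := by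
  rw [outDeg, inDeg, ← Finset.card_union_of_disjoint]
  · exact Finset.card_le_univ _
  · rw [Finset.disjoint_filter]
    exact fun u _ h => hG v u h

lemma card_filter_and_not_add {V : Type*} [Fintype V] {P Q R : V → Prop}
    (hR : ∀ v, R v ↔ P v ∧ ¬ Q v) (hQP : ∀ v, Q v → P v) :
    (Finset.univ.filter R).card + (Finset.univ.filter Q).card = (Finset.univ.filter P).card := by
  rw [← Finset.card_union_of_disjoint]
  · congr 1
    ext v
    have := hR v
    have := hQP v
    simp only [Finset.mem_union, Finset.mem_filter, Finset.mem_univ, true_and]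
    tauto
  · rw [Finset.disjoint_filter]
    exact fun v _ h => ((hR v).mp h).2

/-- Arithmetic for the degrees in a colour-shift subgraph. -/
lemma abs_shift_degree_sub_le {n γ K k d h d' s : ℝ} (hn : 0 ≤ n) (hγ : 0 ≤ γ) (hK : 1 ≤ K)
    (hk : 1 ≤ k) (hd : |d - n / 2| ≤ γ * n) (hh : |h - d / K| ≤ γ * n) (hd' : d' + h = d)
    (hs : |s - d' / k| ≤ γ * n) : |s - (1 - 1 / K) / (2 * k) * n| ≤ 3 * γ * n := by
  have hK0 : 0 < K := by linarith
  have hk0 : 0 < k := by linarith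
  have e : s - (1 - 1 / K) / (2 * k) * n =
      (s - d' / k) + (1 / k) * ((1 - 1 / K) * (d - n / 2) - (h - d / K)) := by
    rw [← hd']
    field_simp
    ring
  have hγn : 0 ≤ γ * n := by positivity
  have h1 : 1 / K ≤ 1 := by rw [div_le_one hK0]; exact hK
  have h2 : 1 / k ≤ 1 := by rw [div_le_one hk0]; exact hk
  have h3 : 0 < 1 / K := by positivity
  have h4 : 0 < 1 / k := by positivity
  have h5 : |(1 - 1 / K) * (d - n / 2) - (h - d / K)| ≤ 2 * (γ * n) := by
    refine (abs_sub _ _).trans ?_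
    rw [abs_mul, abs_of_nonneg (by linarith : 0 ≤ 1 - 1 / K)]
    nlinarith [abs_nonneg (d - n / 2)]
  rw [e]
  refine (abs_add_le _ _).trans ?_
  rw [abs_mul, abs_of_pos h4]
  nlinarith [abs_nonneg ((1 - 1 / K) * (d - n / 2) - (h - d / K))]

/-- Arithmetic bounding the number of bad rounds at a vertex. -/
lemma bad_rounds_le {n γ a : ℝ} {k D τ : ℕ} (hk : 2 ≤ k) (hn : 5 * (k : ℝ) ^ 2 ≤ n) (hγ : 0 ≤ γ)
    (hγk : γ * (9 * (k : ℝ) ^ 2) ≤ 1) (ha : a * (2 * k) ≤ 1)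
    (hD : (D : ℝ) ≤ a * n + 3 * γ * n + 1) (hτ : (τ : ℝ) ≤ 6 * γ * n + 1) :
    (((τ + (D / k + 1)) * (k - 1) : ℕ) : ℝ) * k ≤ 2 * n := by
  have hk2 : (2 : ℝ) ≤ k := by exact_mod_cast hk
  have hn0 : 0 ≤ n := le_trans (by positivity) hn
  have h1 : (((τ + (D / k + 1)) * (k - 1) : ℕ) : ℝ) ≤ τ * k + D + k := by
    have h2 : (τ + (D / k + 1)) * (k - 1) ≤ τ * k + D + k := by
      refine (Nat.mul_le_mul_left _ (Nat.sub_le k 1)).trans ?_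
      have := Nat.div_mul_le_self D k
      nlinarith
    exact_mod_cast h2
  have hk0 : (0 : ℝ) ≤ k := by linarith
  have h3 : a * (2 * k) * n ≤ 1 * n := mul_le_mul_of_nonneg_right ha hn0
  have h4 : γ * (9 * (k : ℝ) ^ 2) * n ≤ 1 * n := mul_le_mul_of_nonneg_right hγk hn0
  have h5 : γ * n * (k * 2) ≤ γ * n * (k * k) :=
    mul_le_mul_of_nonneg_left (mul_le_mul_of_nonneg_left hk2 hk0) (by positivity)
  calc (((τ + (D / k + 1)) * (k - 1) : ℕ) : ℝ) * k ≤
      ((6 * γ * n + 1) * k + (a * n + 3 * γ * n + 1) + k) * k := by gcongr; nlinarith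
    _ = 6 * (γ * n * (k * k)) + 3 / 2 * (γ * n * (k * 2)) + a * (2 * k) * n / 2
        + 2 * (k * k) + k := by ring
    _ ≤ 2 * n := by nlinarith

/-- Arithmetic for the degrees in the reserved subgraph. -/
lemma reserve_degree_ge {n γ K q X d h : ℝ} (hn : 0 ≤ n) (hγ : 0 ≤ γ) (hK : 1 ≤ K)
    (hγq : γ ≤ q / 8) (hqK : q ≤ 1 / (4000 * K)) (hX : X ≤ 3 / 8 * q * n)
    (hd : |d - n / 2| ≤ γ * n) (hh : |h - d / K| ≤ γ * n) : 1 / (4 * K) * n + X ≤ h := by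
  have hK0 : 0 < K := by linarith
  have hK' : 0 < 1 / K := by positivity
  have hK'' : 1 / K ≤ 1 := by rw [div_le_one hK0]; exact hK
  rw [abs_le] at hd hh
  have h1 : (1 / 2 - γ) * n * (1 / K) ≤ d * (1 / K) :=
    mul_le_mul_of_nonneg_right (by linarith) hK'.le
  have h2 : d * (1 / K) = d / K := by ring
  have h3 : 1 / (4 * K) = 1 / 4 * (1 / K) := by field_simp
  have h4 : 1 / (4000 * K) = 1 / 4000 * (1 / K) := by field_simp
  rw [h4] at hqK
  have h5 : q * n ≤ 1 / 4000 * (1 / K) * n := mul_le_mul_of_nonneg_right hqK hn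
  have h6 : γ * n ≤ q / 8 * n := mul_le_mul_of_nonneg_right hγq hn
  have h7 : γ * n * (1 / K) ≤ γ * n * 1 := mul_le_mul_of_nonneg_left hK'' (by positivity)
  have h8 : 0 ≤ 1 / K * n := by positivity
  rw [h3]
  linarith

set_option maxHeartbeats 1000000 in
/-- The main theorem, in terms of the number of vertices. -/
theorem exists_many_hamCycles (η₁ : ℝ) (hη : 0 < η₁) : ∃ n₀ : ℕ, ∃ η₂ : ℝ, 0 < η₂ ∧
    ∀ (V : Type) [Fintype V] [DecidableEq V], n₀ ≤ Fintype.card V →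
    ∀ G : V → V → Prop, (∀ v, ¬ G v v) → (∀ u v : V, G u v → ¬ G v u) →
      (∀ v, (1/2 - η₂) * (Fintype.card V : ℝ) ≤ (outDeg G v : ℝ) ∧
            (1/2 - η₂) * (Fintype.card V : ℝ) ≤ (inDeg G v : ℝ)) →
      ∃ H : Finset (Equiv.Perm V), (∀ σ ∈ H, IsHamCycle G σ) ∧
        (∀ σ ∈ H, ∀ τ ∈ H, σ ≠ τ → ∀ v : V, σ v ≠ τ v) ∧
        (1/2 - η₁) * (Fintype.card V : ℝ) ≤ (H.card : ℝ) := by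
  obtain ⟨K₀, hK₀⟩ := exists_nat_ge (1 / η₁)
  obtain ⟨K, hKdef⟩ : ∃ K, K = K₀ + 1 := ⟨_, rfl⟩
  have hKpos : 0 < K := by omega
  have hK1 : (1 : ℝ) ≤ K := by exact_mod_cast hKpos
  have hKη : 1 / (K : ℝ) ≤ η₁ := by
    have : (1 : ℝ) / η₁ ≤ K := hK₀.trans (by rw [hKdef]; push_cast; linarith)
    rw [div_le_iff₀ hη] at this
    rw [div_le_iff₀ (by linarith)]
    linarith
  obtain ⟨c₃, hc₃, n₁, hham⟩ := exists_hamCycles_of_approx K hK1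
  obtain ⟨q, hq⟩ : ∃ q : ℝ, q = 1 / (4000 * (K : ℝ) ^ 2) := ⟨_, rfl⟩
  rw [← hq] at hham
  have hq0 : 0 < q := by rw [hq]; positivity
  have hqK : q ≤ 1 / (4000 * K) := by
    rw [hq]
    refine one_div_le_one_div_of_le (by positivity) ?_
    nlinarith
  have hq1 : q ≤ 1 / 4000 := hqK.trans (one_div_le_one_div_of_le (by norm_num) (by linarith))
  obtain ⟨k₀, hk₀⟩ := exists_nat_ge (16 / q + 1760 / (c₃ * q) + 1 / η₁)
  obtain ⟨k, hk₀k, hkp⟩ := Nat.exists_infinite_primes k₀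
  have hk2 := hkp.two_le
  have hk2' : (2 : ℝ) ≤ k := by exact_mod_cast hk2
  have hk0 : (0 : ℝ) < k := by linarith
  have hkk : 16 / q + 1760 / (c₃ * q) + 1 / η₁ ≤ k := hk₀.trans (by exact_mod_cast hk₀k)
  have r1 : 0 < 16 / q := by positivity
  have r2 : 0 < 1760 / (c₃ * q) := by positivity
  have r3 : 0 < 1 / η₁ := by positivity
  have hkq : 16 ≤ q * k := by
    have : 16 / q ≤ k := by linarith
    rw [div_le_iff₀ hq0] at this
    linarith
  have hkc : 1760 ≤ c₃ * q * k := by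
    have : 1760 / (c₃ * q) ≤ k := by linarith
    rw [div_le_iff₀ (by positivity)] at this
    linarith
  have hkη : 1 / (k : ℝ) ≤ η₁ := by
    have : 1 / η₁ ≤ k := by linarith
    rw [div_le_iff₀ hη] at this
    rw [div_le_iff₀ hk0]
    linarith
  have : Fact k.Prime := ⟨hkp⟩
  obtain ⟨γ, hγ⟩ : ∃ γ : ℝ, γ = min (q / 8) (1 / (9 * (k : ℝ) ^ 2)) := ⟨_, rfl⟩
  have hγ0 : 0 < γ := by rw [hγ]; positivity
  have hγq : γ ≤ q / 8 := by rw [hγ]; exact min_le_left _ _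
  have hγk : γ * (9 * (k : ℝ) ^ 2) ≤ 1 := by
    rw [← le_div_iff₀ (by positivity), hγ]
    exact min_le_right _ _
  obtain ⟨N₁, hN₁⟩ := exists_proportional_subgraph K hKpos γ hγ0
  obtain ⟨N₂, hN₂⟩ := exists_balanced_vertex_coloring k γ hγ0
  obtain ⟨N₃, hN₃⟩ := exists_nat_ge (8 / q + 2 / c₃ + 5 * (k : ℝ) ^ 2)
  refine ⟨n₁ + N₁ + N₂ + N₃ + 1, γ, hγ0, ?_⟩
  intro V _ _ hn G hirr hG hdeg
  obtain ⟨H, hHG, hHo, hHi, hHe⟩ := hN₁ V (by omega) G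
  obtain ⟨G', hG'⟩ : ∃ G' : V → V → Prop, ∀ u v, G' u v ↔ G u v ∧ ¬ H u v :=
    ⟨_, fun _ _ => Iff.rfl⟩
  obtain ⟨c, hc⟩ := hN₂ V (by omega) G'
  have hn₁ : n₁ ≤ Fintype.card V := by omega
  have hcard0 : 0 < Fintype.card V := by omega
  have hnN₃ : (N₃ : ℝ) ≤ Fintype.card V := by exact_mod_cast (by omega : N₃ ≤ Fintype.card V)
  have hle : ∀ v, (outDeg G v : ℝ) + inDeg G v ≤ Fintype.card V := fun v => by
    exact_mod_cast outDeg_add_inDeg_le G hG v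
  specialize hham V hn₁ hcard0 G H G' hirr hG
  obtain ⟨n, hndef⟩ : ∃ n : ℝ, n = Fintype.card V := ⟨_, rfl⟩
  have hn0 : 0 < n := by rw [hndef]; exact_mod_cast hcard0
  rw [← hndef] at hnN₃
  simp only [← hndef] at hdeg hHo hHi hHe hc hle hham ⊢
  have s1 : 0 < 8 / q := by positivity
  have s2 : 0 < 2 / c₃ := by positivity
  have s3 : 0 < 5 * (k : ℝ) ^ 2 := by positivity
  have hnq : 8 ≤ q * n := by
    have : 8 / q ≤ n := by linarith
    rw [div_le_iff₀ hq0] at this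
    linarith
  have hnc : 2 ≤ c₃ * n := by
    have : 2 / c₃ ≤ n := by linarith
    rw [div_le_iff₀ hc₃] at this
    linarith
  have hnk : 5 * (k : ℝ) ^ 2 ≤ n := by linarith
  obtain ⟨a, ha⟩ : ∃ a : ℝ, a = (1 - 1 / (K : ℝ)) / (2 * k) := ⟨_, rfl⟩
  have hK' : 0 < 1 / (K : ℝ) := by positivity
  have hK'' : 1 / (K : ℝ) ≤ 1 := by rw [div_le_one (by linarith)]; exact hK1
  have ha0 : 0 ≤ a := by rw [ha]; exact div_nonneg (by linarith) (by positivity)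
  have ha1 : a * (2 * k) = 1 - 1 / K := by rw [ha]; field_simp
  have hdo : ∀ v, |(outDeg G v : ℝ) - n / 2| ≤ γ * n := fun v => by
    rw [abs_le]
    constructor <;> linarith [(hdeg v).1, (hdeg v).2, hle v]
  have hdi : ∀ v, |(inDeg G v : ℝ) - n / 2| ≤ γ * n := fun v => by
    rw [abs_le]
    constructor <;> linarith [(hdeg v).1, (hdeg v).2, hle v]
  have ho' : ∀ v, (outDeg G' v : ℝ) + outDeg H v = outDeg G v := fun v => by
    exact_mod_cast card_filter_and_not_add (fun u => hG' v u) (fun u => hHG v u)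
  have hi' : ∀ v, (inDeg G' v : ℝ) + inDeg H v = inDeg G v := fun v => by
    exact_mod_cast card_filter_and_not_add (fun u => hG' u v) (fun u => hHG u v)
  have hso : ∀ s v, |((Finset.univ.filter fun w => G' v w ∧ c w = c v + s).card : ℝ) - a * n| ≤
      3 * γ * n := fun s v => by
    rw [ha]
    exact abs_shift_degree_sub_le hn0.le hγ0.le hK1 (by linarith) (hdo v) (hHo v) (ho' v)
      (hc (c v + s) v).1
  have hsi : ∀ s w, |((Finset.univ.filter fun v => G' v w ∧ c w = c v + s).card : ℝ) - a * n| ≤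
      3 * γ * n := fun s w => by
    have h := abs_shift_degree_sub_le hn0.le hγ0.le hK1 (by linarith) (hdi w) (hHi w) (hi' w)
      (hc (c w - s) w).2
    rw [ha]
    convert h using 6
    rw [eq_sub_iff_add_eq, eq_comm]
  obtain ⟨D, hD⟩ : ∃ D : ℕ, D = ⌈a * n + 3 * γ * n⌉₊ := ⟨_, rfl⟩
  have hD1 : a * n + 3 * γ * n ≤ D := by rw [hD]; exact Nat.le_ceil _
  have hD2 : (D : ℝ) ≤ a * n + 3 * γ * n + 1 := by
    rw [hD]; exact (Nat.ceil_lt_add_one (by positivity)).le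
  obtain ⟨t, ht⟩ : ∃ t : ℕ, t = ⌊6 * γ * n + 1⌋₊ := ⟨_, rfl⟩
  have ht1 : (t : ℝ) ≤ 6 * γ * n + 1 := by rw [ht]; exact Nat.floor_le (by positivity)
  have hdegs : ∀ d : ℕ, |(d : ℝ) - a * n| ≤ 3 * γ * n → d ≤ D ∧ D ≤ d + t := by
    intro d hd
    rw [abs_le] at hd
    refine ⟨by exact_mod_cast (by linarith : (d : ℝ) ≤ D), ?_⟩
    have h1 : D - d ≤ t := by
      rw [ht]
      refine Nat.le_floor ?_
      rcases le_total D d with h | h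
      · rw [Nat.sub_eq_zero_of_le h, Nat.cast_zero]
        positivity
      · rw [Nat.cast_sub h]
        linarith
    omega
  obtain ⟨σ, B, b1, b2, b3, b4, b5⟩ := exists_approx_full_cycles k G' c D t
    (fun s _ v => hdegs _ (hso s v)) (fun s _ v => hdegs _ (hsi s v))
  have hQ := bad_rounds_le hk2 hnk hγ0.le hγk (by linarith) hD2 ht1
  obtain ⟨Q, hQdef⟩ : ∃ Q, Q = (t + (D / k + 1)) * (k - 1) := ⟨_, rfl⟩
  rw [← hQdef] at b4 b5 hQ
  have hQq : (Q : ℝ) ≤ q / 8 * n := by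
    have h1 : (Q : ℝ) * 16 ≤ Q * (q * k) := mul_le_mul_of_nonneg_left hkq (by positivity)
    have h2 : q * (Q * k) ≤ q * (2 * n) := mul_le_mul_of_nonneg_left hQ hq0.le
    linarith
  obtain ⟨L, hL⟩ : ∃ L : ℕ, L = ⌈q / 8 * n⌉₊ := ⟨_, rfl⟩
  have hL1 : q / 8 * n ≤ L := by rw [hL]; exact Nat.le_ceil _
  have hL2 : (L : ℝ) ≤ q / 8 * n + 1 := by
    rw [hL]; exact (Nat.ceil_lt_add_one (by positivity)).le
  have hL0 : 0 < L := by rw [hL]; exact Nat.ceil_pos.mpr (by positivity)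
  obtain ⟨T, hT⟩ : ∃ T : ℕ, T = ⌊c₃ * n⌋₊ := ⟨_, rfl⟩
  have hT1 : (T : ℝ) ≤ c₃ * n := by rw [hT]; exact Nat.floor_le (by positivity)
  have hT2 : c₃ * n / 2 ≤ T := by
    have := Nat.sub_one_lt_floor (c₃ * n)
    rw [← hT] at this
    linarith
  have hX : ((Q + L : ℕ) : ℝ) ≤ 3 / 8 * q * n := by
    push_cast
    linarith
  have hTL : 55 * (Fintype.card V * Q) ≤ T * L := by
    have h1 : c₃ * n / 2 * (q / 8 * n) ≤ T * L := by gcongr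
    have h2 : n * (Q * k) ≤ n * (2 * n) := mul_le_mul_of_nonneg_left hQ hn0.le
    have h3 : n * Q * 1760 ≤ n * Q * (c₃ * q * k) :=
      mul_le_mul_of_nonneg_left hkc (by positivity)
    have h4 : c₃ * q * (n * (Q * k)) ≤ c₃ * q * (n * (2 * n)) :=
      mul_le_mul_of_nonneg_left h2 (by positivity)
    have h5 : 55 * (n * Q) ≤ T * L := by linarith
    rw [hndef] at h5
    exact_mod_cast h5
  have hHdeg : ∀ d h : ℝ, |d - n / 2| ≤ γ * n → |h - d / K| ≤ γ * n →
      1 / (4 * (K : ℝ)) * n + (Q + L : ℕ) ≤ h :=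
    fun d h => reserve_degree_ge hn0.le hγ0.le hK1 hγq hqK hX
  obtain ⟨Hs, u1, u2, u3⟩ := hham
    (fun v => by
      have h1 : (499 / 1000 : ℝ) ≤ 1 / 2 - γ := by linarith
      have h2 := mul_le_mul_of_nonneg_right h1 hn0.le
      exact ⟨h2.trans (hdeg v).1, h2.trans (hdeg v).2⟩)
    hHG (fun u v h => (hG' u v).mp h) ((k - 1) * D) L Q T hL0 hT1 hTL
    (fun v => ⟨hHdeg _ _ (hdo v) (hHo v), hHdeg _ _ (hdi v) (hHi v)⟩)
    (fun S T => by
      have h1 := (abs_le.mp (hHe S T)).1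
      have h2 := mul_le_mul_of_nonneg_right hX hn0.le
      have h3 : γ * n ^ 2 ≤ q / 8 * n ^ 2 := mul_le_mul_of_nonneg_right hγq (by positivity)
      have h4 : 0 ≤ q * n ^ 2 := by positivity
      linarith) σ B b1 b2 b3 b4 b5
  refine ⟨Hs, u1, u2, ?_⟩
  rw [u3, Nat.cast_mul, Nat.cast_sub (by omega), Nat.cast_one]
  have h1 : a * n ≤ D := by
    have : 0 ≤ 3 * γ * n := by positivity
    linarith
  have h2 : ((k : ℝ) - 1) * (a * n) ≤ (k - 1) * D := mul_le_mul_of_nonneg_left h1 (by linarith)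
  refine le_trans ?_ h2
  have h3 : ((k : ℝ) - 1) * (a * n) = 1 / 2 * ((1 - 1 / k) * (1 - 1 / K)) * n := by
    rw [ha]
    field_simp
  rw [h3]
  refine mul_le_mul_of_nonneg_right ?_ hn0.le
  have h4 : 0 < 1 / (k : ℝ) := by positivity
  nlinarith [mul_pos h4 hK']

end Main

/-- for every `η₁ > 0` there are `n₀` and `η₂ > 0` such that every oriented
graph on `n ≥ n₀` vertices with all in- and outdegrees at least `(1/2 − η₂)n` contains at
least `(1/2 − η₁)n` pairwise edge-disjoint Hamilton cycles. -/
theorem oriented_graph_nearly_regular_many_edge_disjoint_hamilton_cycles :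
    ∀ η₁ : ℝ, 0 < η₁ →
    ∃ n₀ : ℕ, ∃ η₂ : ℝ, 0 < η₂ ∧
    ∀ n : ℕ, n₀ ≤ n →
    ∀ (V : Type) [Fintype V] [DecidableEq V], Fintype.card V = n →
    ∀ G : V → V → Prop,
      (∀ v, ¬ G v v) →
      (∀ u v : V, G u v → ¬ G v u) →
      (∀ v, (1/2 - η₂) * (n : ℝ) ≤ (outDeg G v : ℝ) ∧
            (1/2 - η₂) * (n : ℝ) ≤ (inDeg G v : ℝ)) →
      ∃ H : Finset (Equiv.Perm V),
        (∀ σ ∈ H, IsHamCycle G σ) ∧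
        (∀ σ ∈ H, ∀ τ ∈ H, σ ≠ τ → ∀ v : V, σ v ≠ τ v) ∧
        (1/2 - η₁) * (n : ℝ) ≤ (H.card : ℝ) := by
  intro η₁ hη
  obtain ⟨n₀, η₂, hη₂, h⟩ := exists_many_hamCycles η₁ hη
  refine ⟨n₀, η₂, hη₂, fun n hn V _ _ hV => ?_⟩
  subst hV
  exact h V hn
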